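/- arXiv:2204.13882 — 7 statements merged into one kernel-verified Lean document; each statement's English description precedes it below -/
import Mathlib

section
/- Let p ≥ 5 be a prime, q = p^n a prime power, and let m = k·l with k > 1 a divisor of q − 1 and l ≥ 1 equal to the multiplicative order of q modulo m. Let a ∈ F_q* be such that x^m − a is irreducible over F_q, and let θ be the image of x in F_q[x]/⟨x^m − a⟩. Then for every b ∈ F_q*, the multiplicative order of θ^l + b in (F_q[x]/⟨x^m − a⟩)* is at least d₁ := max over integers 0 ≤ d₋ ≤ d < k of binom(k, d₋) · binom(d, d₋) · binom(2k − d − d₋ − 1, k − d − 1). -/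
open Polynomial

/-- If products of fewer than `card ι` of the `g i` (with multiplicity) determine the multiset of
indices, then integer exponent vectors with exactly `r` negative entries, negative part of total
at most `d` and positive part of total at most `card ι - 1 - d`, give distinct elements. -/
theorem choose_mul_choose_mul_choose_le_natCard {G ι : Type*} [CommGroup G] [Fintype ι]
    [DecidableEq ι] (g : ι → G)
    (hg : ∀ e f : ι → ℕ, ∑ i, e i < Fintype.card ι → ∑ i, f i < Fintype.card ι →
      ∏ i, g i ^ e i = ∏ i, g i ^ f i → e = f)
    (H : Subgroup G) [Finite H] (hH : ∀ i, g i ∈ H) {r d : ℕ} (hrd : r ≤ d)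
    (hd : d < Fintype.card ι) :
    (Fintype.card ι).choose r * d.choose r *
      (2 * Fintype.card ι - d - r - 1).choose (Fintype.card ι - d - 1) ≤ Nat.card H := by
  classical
  set k := Fintype.card ι
  let A : Finset (Σ _ : Finset ι, (Option ι →₀ ℕ) × (Option ι →₀ ℕ)) :=
    (Finset.powersetCard r Finset.univ).sigma fun T =>
      (Finset.insertNone T).finsuppAntidiag (d - r) ×ˢ
        (Finset.insertNone Tᶜ).finsuppAntidiag (k - d - 1)
  have hA : A.card = k.choose r * d.choose r * (2 * k - d - r - 1).choose (k - d - 1) := by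
    rw [Finset.card_sigma, Finset.sum_congr rfl (g := fun _ => d.choose r *
      (2 * k - d - r - 1).choose (k - d - 1)), Finset.sum_const, Finset.card_powersetCard,
      Finset.card_univ, smul_eq_mul, mul_assoc]
    intro T hT
    have hT := (Finset.mem_powersetCard.1 hT).2
    rw [Finset.card_product, Finset.card_finsuppAntidiag_nat_eq_choose,
      Finset.card_finsuppAntidiag_nat_eq_choose, Finset.card_insertNone, Finset.card_insertNone,
      Finset.card_compl, hT]
    congr 1
    · rw [show r + 1 + (d - r) - 1 = d by lia, Nat.choose_symm hrd]
    · congr 1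
      change k - r + 1 + (k - d - 1) - 1 = _
      lia
  let pos (x : Σ _ : Finset ι, (Option ι →₀ ℕ) × (Option ι →₀ ℕ)) (i : ι) : ℕ := x.2.2 (some i)
  let neg (x : Σ _ : Finset ι, (Option ι →₀ ℕ) × (Option ι →₀ ℕ)) (i : ι) : ℕ :=
    if i ∈ x.1 then x.2.1 (some i) + 1 else 0
  have hpos : ∀ x ∈ A, ∑ i, pos x i ≤ k - d - 1 := by
    rintro ⟨T, u, v⟩ hx
    simp only [A, Finset.mem_sigma, Finset.mem_product, Finset.mem_finsuppAntidiag] at hx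
    obtain ⟨-, -, hv, hs⟩ := hx
    rw [← hv, ← Finset.sum_subset (Finset.subset_univ Tᶜ)]
    · simp [pos, Finset.sum_insertNone]
    · intro i _ hi
      by_contra h
      exact hi (by simpa using hs (Finsupp.mem_support_iff.2 h))
  have hneg : ∀ x ∈ A, ∑ i, neg x i ≤ d := by
    rintro ⟨T, u, v⟩ hx
    simp only [A, Finset.mem_sigma, Finset.mem_product, Finset.mem_finsuppAntidiag,
      Finset.mem_powersetCard] at hx
    obtain ⟨⟨-, hT⟩, ⟨hu, -⟩, -⟩ := hx
    rw [Finset.sum_insertNone] at hu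
    have : ∑ i, neg ⟨T, u, v⟩ i = ∑ i ∈ T, u (some i) + r := by
      simp [neg, Finset.sum_ite_mem, Finset.sum_add_distrib, hT]
    lia
  have hdisj : ∀ x ∈ A, ∀ i ∈ x.1, pos x i = 0 := by
    rintro ⟨T, u, v⟩ hx i hi
    simp only [A, Finset.mem_sigma, Finset.mem_product, Finset.mem_finsuppAntidiag] at hx
    by_contra h
    have := hx.2.2.2 (Finsupp.mem_support_iff.2 h)
    simp at this
    exact this hi
  let φ (x : Σ _ : Finset ι, (Option ι →₀ ℕ) × (Option ι →₀ ℕ)) : G :=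
    (∏ i, g i ^ pos x i) * (∏ i, g i ^ neg x i)⁻¹
  have hφH : ∀ x, φ x ∈ H := fun x =>
    H.mul_mem (H.prod_mem fun i _ => H.pow_mem (hH i) _)
      (H.inv_mem (H.prod_mem fun i _ => H.pow_mem (hH i) _))
  have hinj : Set.InjOn φ A := by
    intro x hx y hy hxy
    have hx' := Finset.mem_coe.1 hx
    have hy' := Finset.mem_coe.1 hy
    have key : (fun i => pos x i + neg y i) = fun i => pos y i + neg x i := by
      apply hg
      · have := hpos x hx'; have := hneg y hy'
        rw [Finset.sum_add_distrib]; lia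
      · have := hpos y hy'; have := hneg x hx'
        rw [Finset.sum_add_distrib]; lia
      · simp only [pow_add, Finset.prod_mul_distrib]
        exact mul_inv_eq_mul_inv_iff_mul_eq_mul.1 hxy
    have hT : x.1 = y.1 := by
      ext i
      have hi := congrFun key i
      have hxi := hdisj x hx' i
      have hyi := hdisj y hy' i
      by_cases h1 : i ∈ x.1 <;> by_cases h2 : i ∈ y.1 <;> simp_all [neg]
    obtain ⟨T, u, v⟩ := x
    obtain ⟨T', u', v'⟩ := y
    obtain rfl : T = T' := hT
    have hv : ∀ i, v (some i) = v' (some i) := by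
      intro i
      have hi := congrFun key i
      have hxi := hdisj _ hx' i
      have hyi := hdisj _ hy' i
      by_cases h1 : i ∈ T
      · exact (hxi h1).trans (hyi h1).symm
      · simpa [neg, pos, h1] using hi
    have hu : ∀ i ∈ T, u (some i) = u' (some i) := by
      intro i h1
      have hi := congrFun key i
      have hxi := hdisj _ hx' i h1
      have hyi := hdisj _ hy' i h1
      simp_all [neg, pos]
    simp only [A, Finset.mem_sigma, Finset.mem_product, Finset.mem_finsuppAntidiag,
      Finset.sum_insertNone] at hx' hy'
    obtain ⟨-, ⟨hu1, hu2⟩, hv1, -⟩ := hx'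
    obtain ⟨-, ⟨hu3, hu4⟩, hv3, -⟩ := hy'
    have e1 : v = v' := by
      ext (_ | i)
      · rw [Finset.sum_congr rfl fun i _ => hv i] at hv1
        lia
      · exact hv i
    have e2 : u = u' := by
      ext (_ | i)
      · rw [Finset.sum_congr rfl hu] at hu1
        lia
      · by_cases h : i ∈ T
        · exact hu i h
        · rw [Finsupp.notMem_support_iff.1 fun h' => h (by simpa using hu2 h'),
            Finsupp.notMem_support_iff.1 fun h' => h (by simpa using hu4 h')]
    rw [e1, e2]
  rw [← hA, ← Nat.card_eq_finsetCard]
  exact Nat.card_le_card_of_injective (fun x : A => (⟨φ x, hφH x⟩ : H)) fun x y hxy =>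
    Subtype.ext (hinj x.2 y.2 (congrArg Subtype.val hxy))

theorem FiniteField.mem_range_algebraMap_of_pow_card_eq {F K : Type*} [Field F] [Fintype F]
    [Field K] [Algebra F K] {z : K} (hz : z ^ Fintype.card F = z) :
    z ∈ Set.range (algebraMap F K) := by
  have hs : (X ^ Fintype.card F - X : F[X]).Splits := by
    rw [splits_iff_card_roots, FiniteField.roots_X_pow_card_sub_X,
      FiniteField.X_pow_card_sub_X_natDegree_eq F Fintype.one_lt_card]
    rfl
  refine hs.mem_range_of_isRoot (FiniteField.X_pow_card_sub_X_ne_zero F Fintype.one_lt_card) ?_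
  simp [hz]

/-- Products of powers of pairwise non-associate linear forms `C (c i) * X + C b` determine the
exponents. -/
theorem prod_C_mul_X_add_C_pow_injective {F ι : Type*} [Field F] [Fintype ι] {c : ι → F}
    (hc : Function.Injective c) (hc0 : ∀ i, c i ≠ 0) {b : F} (hb : b ≠ 0) :
    Function.Injective fun e : ι → ℕ => ∏ i, (C (c i) * X + C b) ^ e i := by
  classical
  intro e f hef
  have hlin : ∀ i, C (c i) * X + C b ≠ 0 := fun i h => by
    have := congrArg (coeff · 0) h
    simp [hb] at this
  have hroots : ∀ (e : ι → ℕ) j,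
      (∏ i, (C (c i) * X + C b) ^ e i).roots.count (-((c j)⁻¹ * b)) = e j := by
    intro e j
    rw [roots_prod _ _ (Finset.prod_ne_zero_iff.2 fun i _ => pow_ne_zero _ (hlin i)),
      Multiset.count_bind]
    simp only [roots_pow, roots_C_mul_X_add_C b (hc0 _), Multiset.count_nsmul,
      Multiset.count_singleton]
    change ∑ i, _ = _
    rw [Finset.sum_eq_single j]
    · simp
    · intro i _ hij
      have : ¬ (-((c j)⁻¹ * b) = -((c i)⁻¹ * b)) := by
        simpa [hb] using fun h => hij (hc h.symm)
      simp [this]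
    · simp
  ext j
  rw [← hroots e j, ← hroots f j]
  exact congrArg (fun P : F[X] => P.roots.count _) hef

theorem choose_mul_choose_mul_choose_le_orderOf {F K : Type*} [Field F] [Fintype F] [Field K]
    [Algebra F K] {k : ℕ} (hk : 1 < k) (hkdvd : k ∣ Fintype.card F - 1) {a b : F} (ha : a ≠ 0)
    (hb : b ≠ 0) {y : K} (hy : y ^ k = algebraMap F K a)
    (hdeg : ∀ P : F[X], P.natDegree < k → aeval y P = 0 → P = 0)
    {r d : ℕ} (hrd : r ≤ d) (hd : d < k) :
    k.choose r * d.choose r * (2 * k - d - r - 1).choose (k - d - 1) ≤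
      orderOf (y + algebraMap F K b) := by
  set q := Fintype.card F
  have hq : 1 < q := Fintype.one_lt_card
  obtain ⟨t, ht⟩ := hkdvd
  set ζ : F := a ^ t with hζ
  have hζ0 : ζ ≠ 0 := pow_ne_zero _ ha
  have hyq : y ^ q = algebraMap F K ζ * y := by
    rw [show q = k * t + 1 by lia, pow_succ, pow_mul, hy, ← map_pow]
  have hζk : ζ ^ k = 1 := by
    rw [← pow_mul, mul_comm, ← ht, FiniteField.pow_card_sub_one_eq_one a ha]
  have hζ1 : ∀ j, 0 < j → j < k → ζ ^ j ≠ 1 := by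
    intro j hj hjk h
    obtain ⟨c, hc⟩ := FiniteField.mem_range_algebraMap_of_pow_card_eq (F := F) (z := y ^ j) (by
      rw [← pow_mul, mul_comm, pow_mul]
      change (y ^ q) ^ j = _
      rw [hyq, mul_pow, ← map_pow, h, map_one, one_mul])
    refine X_pow_sub_C_ne_zero hj c (hdeg _ ?_ ?_)
    · rwa [natDegree_X_pow_sub_C]
    · simp [hc]
  have hprim : IsPrimitiveRoot ζ k := IsPrimitiveRoot.mk_of_lt ζ (by lia) hζk hζ1
  have hc : Function.Injective fun i : Fin k => ζ ^ (i : ℕ) := fun i j hij =>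
    Fin.ext (hprim.pow_inj i.2 j.2 hij)
  have hc0 : ∀ i : Fin k, ζ ^ (i : ℕ) ≠ 0 := fun i => pow_ne_zero _ hζ0
  have hconj : ∀ i : ℕ, (y + algebraMap F K b) ^ q ^ i =
      algebraMap F K (ζ ^ i) * y + algebraMap F K b := by
    intro i
    induction i with
    | zero => simp
    | succ i ih =>
      rw [pow_succ, pow_mul, ih]
      have := map_add (FiniteField.frobeniusAlgHom F K) (algebraMap F K (ζ ^ i) * y)
        (algebraMap F K b)
      rw [map_mul, AlgHom.commutes, AlgHom.commutes] at this
      simp only [FiniteField.coe_frobeniusAlgHom] at this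
      change _ ^ q = _ * y ^ q + _ at this
      rw [this, hyq, ← mul_assoc, ← map_mul, pow_succ]
  have hα : y + algebraMap F K b ≠ 0 := by
    intro h
    refine X_add_C_ne_zero b (hdeg _ ?_ ?_)
    · rwa [natDegree_X_add_C]
    · simpa using h
  set α : Kˣ := Units.mk0 _ hα
  have hfin : IsOfFinOrder α := by
    refine isOfFinOrder_iff_pow_eq_one.2 ⟨q ^ k - 1, ?_, ?_⟩
    · have := Nat.one_lt_pow (n := k) (by lia) hq
      lia
    · have h1 : α ^ q ^ k = α := Units.ext (by simp [α, hconj, hζk])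
      rw [← mul_right_cancel_iff (a := α), one_mul, ← pow_succ, Nat.sub_add_cancel, h1]
      exact Nat.one_le_pow _ _ (by lia)
  have : Finite (Subgroup.zpowers α) := hfin.finite_zpowers
  have horder : Nat.card (Subgroup.zpowers α) = orderOf (y + algebraMap F K b) := by
    rw [Nat.card_zpowers, ← orderOf_units]
    rfl
  have main := choose_mul_choose_mul_choose_le_natCard (fun i : Fin k => α ^ q ^ (i : ℕ)) ?_
    (Subgroup.zpowers α) (fun i => Subgroup.npow_mem_zpowers _ _) hrd (by simpa using hd)
  · simpa [horder] using main
  intro e f he hf hef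
  rw [Fintype.card_fin] at he hf
  apply prod_C_mul_X_add_C_pow_injective hc hc0 hb
  have hnat : ∀ e : Fin k → ℕ, ∑ i, e i < k →
      (∏ i : Fin k, (C (ζ ^ (i : ℕ)) * X + C b) ^ e i).natDegree < k := by
    intro e he
    refine ((natDegree_prod_le _ _).trans (Finset.sum_le_sum fun i _ => ?_)).trans_lt he
    exact natDegree_pow_le_of_le _ natDegree_linear_le |>.trans (by simp)
  refine sub_eq_zero.1 (hdeg _ ?_ ?_)
  · exact (natDegree_sub_le _ _).trans_lt (max_lt (hnat e he) (hnat f hf))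
  · have := congrArg (fun u : Kˣ => (u : K)) hef
    simp only [Units.coe_prod, Units.val_pow_eq_pow_val, α, Units.val_mk0, hconj] at this
    simpa [sub_eq_zero] using this

theorem AdjoinRoot.eq_zero_of_aeval_root_pow_eq_zero {F : Type*} [Field F] {f P : F[X]} {k l : ℕ}
    (hl : 0 < l) (hf : f.natDegree = k * l) (hP : P.natDegree < k)
    (h : aeval (AdjoinRoot.root f ^ l) P = 0) : P = 0 := by
  rw [← expand_aeval, AdjoinRoot.aeval_eq, AdjoinRoot.mk_eq_zero] at h
  rw [← expand_eq_zero hl]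
  refine eq_zero_of_dvd_of_natDegree_lt h ?_
  rw [natDegree_expand, hf]
  exact Nat.mul_lt_mul_of_pos_right hP hl

/-- Theorem 1 of the paper: the multiplicative order of `θ^l + b` in
`F_q[x]/⟨x^m − a⟩` is at least
`d₁ = max_{0 ≤ d₋ ≤ d < k} C(k, d₋)·C(d, d₋)·C(2k − d − d₋ − 1, k − d − 1)`. -/
theorem order_of_theta_pow_l_add_b_ge_d1
    (p n q m k l : ℕ) (hp : p.Prime) (hp5 : 5 ≤ p) (hn : 0 < n) (hq : q = p ^ n)
    (hk : 1 < k) (hkdvd : k ∣ q - 1) (hm : m = k * l) (hl : 1 ≤ l)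
    (hord : orderOf (q : ZMod m) = l)
    (F : Type*) [Field F] [Fintype F] (hcard : Fintype.card F = q)
    (a : F) (ha : a ≠ 0) (hirr : Irreducible (X ^ m - C a))
    (b : F) (hb : b ≠ 0) :
    ((Finset.range k ×ˢ Finset.range k).filter fun x => x.1 ≤ x.2).sup
        (fun x => k.choose x.1 * x.2.choose x.1 *
          (2 * k - x.2 - x.1 - 1).choose (k - x.2 - 1)) ≤
      orderOf ((AdjoinRoot.root (X ^ m - C a)) ^ l + AdjoinRoot.of (X ^ m - C a) b) := by
  subst hcard
  have : Fact (Irreducible (X ^ m - C a)) := ⟨hirr⟩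
  have hroot : (AdjoinRoot.root (X ^ m - C a) ^ l) ^ k =
      algebraMap F (AdjoinRoot (X ^ m - C a)) a := by
    have h := AdjoinRoot.eval₂_root (X ^ m - C a)
    rw [eval₂_sub, eval₂_X_pow, eval₂_C, sub_eq_zero] at h
    rw [← pow_mul, mul_comm l, ← hm, h, AdjoinRoot.algebraMap_eq]
  rw [← AdjoinRoot.algebraMap_eq]
  refine Finset.sup_le fun x hx => ?_
  rw [Finset.mem_filter, Finset.mem_product, Finset.mem_range, Finset.mem_range] at hx
  exact choose_mul_choose_mul_choose_le_orderOf hk hkdvd ha hb hroot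
    (fun P hP h => AdjoinRoot.eq_zero_of_aeval_root_pow_eq_zero hl
      (natDegree_X_pow_sub_C.trans hm) hP h) hx.2 hx.1.2
end

section
/- For every integer k ≥ 70, the quantity d₁ := max over integers 0 ≤ d₋ ≤ d < k of binom(k, d₋) · binom(d, d₋) · binom(2k − d − d₋ − 1, k − d − 1) satisfies d₁ ≥ 5^k. -/
/-- A weak form of Vandermonde's identity: keep only one term of the sum. -/
theorem Nat.choose_mul_choose_le_choose_add (m n r s : ℕ) :
    m.choose r * n.choose s ≤ (m + n).choose (r + s) := by
  rw [Nat.add_choose_eq]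
  exact Finset.single_le_sum (f := fun x : ℕ × ℕ => m.choose x.1 * n.choose x.2)
    (fun _ _ => Nat.zero_le _) (Finset.HasAntidiagonal.mem_antidiagonal (a := (r, s)) |>.mpr rfl)

theorem five_pow_le_choose_product_base :
    ∀ i < 38, 5 ^ (70 + i) ≤
      (70 + i).choose (2 * (70 + i) / 7) *
        (17 * (70 + i) / 35).choose (2 * (70 + i) / 7) *
        (2 * (70 + i) - 17 * (70 + i) / 35 - 2 * (70 + i) / 7 - 1).choose
          (70 + i - 17 * (70 + i) / 35 - 1) := by
  simp only [Nat.choose_eq_descFactorial_div_factorial]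
  decide +kernel

theorem exists_five_pow_le_choose_product (k : ℕ) (hk : 70 ≤ k) :
    ∃ a d, a ≤ d ∧ d < k ∧
      5 ^ k ≤ k.choose a * d.choose a * (2 * k - d - a - 1).choose (k - d - 1) := by
  induction k using Nat.strong_induction_on with
  | _ k ih =>
    rcases lt_or_ge k 108 with h | h
    · obtain ⟨i, rfl⟩ := Nat.exists_eq_add_of_le hk
      exact ⟨2 * (70 + i) / 7, 17 * (70 + i) / 35, by omega, by omega,
        five_pow_le_choose_product_base i (by omega)⟩
    · obtain ⟨n, rfl⟩ := Nat.exists_eq_add_of_le' (show 38 ≤ k by omega)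
      obtain ⟨a, d, had, hdn, hle⟩ := ih n (by omega) (by omega)
      refine ⟨a + 11, d + 19, by omega, by omega, ?_⟩
      have step : 5 ^ 38 ≤ Nat.choose 38 11 * Nat.choose 19 11 * Nat.choose 46 19 := by
        simp only [Nat.choose_eq_descFactorial_div_factorial]
        decide +kernel
      have htop : 2 * (n + 38) - (d + 19) - (a + 11) - 1 = 2 * n - d - a - 1 + 46 := by omega
      have hbot : n + 38 - (d + 19) - 1 = n - d - 1 + 19 := by omega
      rw [htop, hbot, pow_add]
      calc 5 ^ n * 5 ^ 38
          ≤ (n.choose a * d.choose a * (2 * n - d - a - 1).choose (n - d - 1)) *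
              (Nat.choose 38 11 * Nat.choose 19 11 * Nat.choose 46 19) :=
            Nat.mul_le_mul hle step
        _ = (n.choose a * Nat.choose 38 11) * (d.choose a * Nat.choose 19 11) *
              ((2 * n - d - a - 1).choose (n - d - 1) * Nat.choose 46 19) := by ac_rfl
        _ ≤ _ := Nat.mul_le_mul
            (Nat.mul_le_mul (Nat.choose_mul_choose_le_choose_add _ _ _ _)
              (Nat.choose_mul_choose_le_choose_add _ _ _ _))
            (Nat.choose_mul_choose_le_choose_add _ _ _ _)

/-- For every `k ≥ 70`, the quantity
`d₁ = max_{0 ≤ d₋ ≤ d < k} C(k, d₋)·C(d, d₋)·C(2k − d − d₋ − 1, k − d − 1)`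
satisfies `d₁ ≥ 5^k`. -/
theorem d1_ge_five_pow (k : ℕ) (hk : 70 ≤ k) :
    5 ^ k ≤
      ((Finset.range k ×ˢ Finset.range k).filter fun x => x.1 ≤ x.2).sup
        (fun x => k.choose x.1 * x.2.choose x.1 *
          (2 * k - x.2 - x.1 - 1).choose (k - x.2 - 1)) := by
  obtain ⟨a, d, had, hdk, hle⟩ := exists_five_pow_le_choose_product k hk
  refine hle.trans (Finset.le_sup (f := fun x : ℕ × ℕ => k.choose x.1 * x.2.choose x.1 *
    (2 * k - x.2 - x.1 - 1).choose (k - x.2 - 1)) (b := (a, d)) ?_)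
  simp only [Finset.mem_filter, Finset.mem_product, Finset.mem_range]
  omega
end

section
/- Let p ≥ 5 be a prime, q = p^n a prime power, and let m = k·l with k > 1 a divisor of q − 1 and l ≥ 1 equal to the multiplicative order of q modulo m. Let a ∈ F_q* be such that x^m − a is irreducible over F_q, and let θ be the image of x in F_q[x]/⟨x^m − a⟩. Let T be the set of integer vectors (u_0, …, u_{l−1}) such that 0 ≤ u_i ≤ p − 1 for all i and Σ_{i=0}^{l−1} (i·k + 1)·u_i < m. Then for every b ∈ F_q*, the multiplicative order of θ + b in (F_q[x]/⟨x^m − a⟩)* is at least |T|. -/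
open Polynomial

/-- `P` agrees with `B * (1 + s * X ^ e)` modulo `X ^ (e + 1)`. -/
def HasLeadingTerms {F : Type*} [Field F] (e : ℕ) (P : F[X]) (B s : F) : Prop :=
  X ^ (e + 1) ∣ P - C B * (1 + C s * X ^ e)

namespace HasLeadingTerms

variable {F : Type*} [Field F] {e : ℕ}

theorem one : HasLeadingTerms e (1 : F[X]) 1 0 := by
  simp [HasLeadingTerms]

theorem mul (he : 0 < e) {P Q : F[X]} {B B' s s' : F}
    (hP : HasLeadingTerms e P B s) (hQ : HasLeadingTerms e Q B' s') :
    HasLeadingTerms e (P * Q) (B * B') (s + s') := by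
  obtain ⟨R, hR⟩ := hP
  obtain ⟨R', hR'⟩ := hQ
  obtain ⟨d, rfl⟩ : ∃ d, e = d + 1 := ⟨e - 1, by omega⟩
  rw [sub_eq_iff_eq_add] at hR hR'
  refine ⟨R * Q + C B * (1 + C s * X ^ (d + 1)) * R' + C (B * B' * s * s') * X ^ d, ?_⟩
  rw [hR, hR']
  simp only [C_mul, C_add]
  ring

theorem pow (he : 0 < e) {P : F[X]} {B s : F} (hP : HasLeadingTerms e P B s) (n : ℕ) :
    HasLeadingTerms e (P ^ n) (B ^ n) (n * s) := by
  induction n with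
  | zero => simpa using one
  | succ n ih =>
    have := ih.mul he hP
    rw [pow_succ, pow_succ]
    convert this using 1
    push_cast
    ring

theorem prod (he : 0 < e) {ι : Type*} (S : Finset ι) {P : ι → F[X]} {B s : ι → F}
    (h : ∀ i ∈ S, HasLeadingTerms e (P i) (B i) (s i)) :
    HasLeadingTerms e (∏ i ∈ S, P i) (∏ i ∈ S, B i) (∑ i ∈ S, s i) := by
  classical
  induction S using Finset.induction_on with
  | empty => simpa using one
  | insert i S hi ih =>
    rw [Finset.prod_insert hi, Finset.prod_insert hi, Finset.sum_insert hi]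
    exact (h i (by simp)).mul he (ih fun j hj => h j (by simp [hj]))

theorem unique (he : 0 < e) {P : F[X]} {B B' s s' : F} (hB : B ≠ 0)
    (h : HasLeadingTerms e P B s) (h' : HasLeadingTerms e P B' s') : s = s' := by
  rw [HasLeadingTerms, X_pow_dvd_iff] at h h'
  have h0 := h 0 (by omega)
  have h0' := h' 0 (by omega)
  have h1 := h e (by omega)
  have h1' := h' e (by omega)
  simp [he.ne, mul_add, coeff_X_pow] at h0 h0' h1 h1'
  have hBB : B = B' := (sub_eq_zero.1 h0).symm.trans (sub_eq_zero.1 h0')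
  subst hBB
  exact mul_left_cancel₀ hB
    (add_left_cancel ((sub_eq_zero.1 h1).symm.trans (sub_eq_zero.1 h1')))

end HasLeadingTerms

theorem eq_of_prod_binomial_pow_eq {F : Type*} [Field F] {p l : ℕ} [CharP F p]
    {e : Fin l → ℕ} (he : StrictMono e) (he0 : ∀ i, 0 < e i) {c : Fin l → F}
    (hc : ∀ i, c i ≠ 0) {b : F} (hb : b ≠ 0) {u v : Fin l → ℕ}
    (hu : ∀ i, u i < p) (hv : ∀ i, v i < p)
    (h : ∏ i, (C (c i) * X ^ e i + C b) ^ u i = ∏ i, (C (c i) * X ^ e i + C b) ^ v i) :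
    u = v := by
  have hne : ∀ i, C (c i) * X ^ e i + C b ≠ 0 := fun i h0 => hb <| by
    simpa [(he0 i).ne] using congrArg (coeff · 0) h0
  funext i
  induction i using WellFoundedLT.induction with
  | ind i ih =>
  have hbase : ∀ j ∈ Finset.univ.filter (¬ · < i),
      HasLeadingTerms (e i) (C (c j) * X ^ e j + C b) b (if j = i then c i / b else 0) := by
    intro j hj
    rcases (not_lt.1 (Finset.mem_filter.1 hj).2).eq_or_lt with rfl | hij
    · rw [if_pos rfl, HasLeadingTerms, mul_add, ← mul_assoc, ← C_mul, mul_div_cancel₀ _ hb]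
      ring_nf
      exact dvd_zero _
    · rw [if_neg hij.ne', HasLeadingTerms]
      simpa using (pow_dvd_pow X (he hij)).mul_left (C (c j))
  have hterms : ∀ w : Fin l → ℕ, HasLeadingTerms (e i)
      (∏ j with ¬ j < i, (C (c j) * X ^ e j + C b) ^ w j) (∏ j with ¬ j < i, b ^ w j)
      (w i * (c i / b)) := by
    intro w
    have := HasLeadingTerms.prod (he0 i) _ fun j hj => (hbase j hj).pow (he0 i) (w j)
    simpa [Finset.sum_ite_eq] using this
  have hcancel : ∏ j with ¬ j < i, (C (c j) * X ^ e j + C b) ^ u j =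
      ∏ j with ¬ j < i, (C (c j) * X ^ e j + C b) ^ v j := by
    rw [← Finset.prod_filter_mul_prod_filter_not _ (· < i),
      ← Finset.prod_filter_mul_prod_filter_not (f := fun j => _ ^ v j) _ (· < i),
      Finset.prod_congr rfl fun j hj => by rw [ih j (Finset.mem_filter.1 hj).2]] at h
    exact mul_left_cancel₀ (Finset.prod_ne_zero_iff.2 fun j _ => pow_ne_zero _ (hne j)) h
  have huv := (hterms u).unique (he0 i)
    (Finset.prod_ne_zero_iff.2 fun j _ => pow_ne_zero _ hb) (hcancel ▸ hterms v)
  have hcast := mul_right_cancel₀ (div_ne_zero (hc i) hb) huv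
  exact ((CharP.natCast_eq_natCast F p).1 hcast).eq_of_lt_of_lt (hu i) (hv i)

theorem exists_pow_mod_eq {q k l : ℕ} (hk : 1 < k) (hkdvd : k ∣ q - 1) (hq : 0 < q) (hl : 1 ≤ l)
    (hord : orderOf (q : ZMod (k * l)) = l) (i : Fin l) :
    ∃ j, q ^ j % (k * l) = i * k + 1 := by
  have hmod : ∀ j, q ^ j % (k * l) % k = 1 := by
    intro j
    rw [Nat.mod_mul_right_mod]
    have h1 : q ≡ 1 [MOD k] := ((Nat.modEq_iff_dvd' hq).2 hkdvd).symm
    have := h1.pow j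
    rw [one_pow] at this
    rw [this, Nat.mod_eq_of_lt hk]
  have hlt : ∀ j, q ^ j % (k * l) / k < l := fun j =>
    Nat.div_lt_of_lt_mul (Nat.mod_lt _ (by positivity))
  have hdiv : ∀ j, q ^ j % (k * l) = q ^ j % (k * l) / k * k + 1 := by
    intro j
    have := Nat.div_add_mod' (q ^ j % (k * l)) k
    rw [hmod j] at this
    exact this.symm
  let f : Fin l → Fin l := fun j => ⟨q ^ (j : ℕ) % (k * l) / k, hlt j⟩
  have hf : Function.Injective f := by
    intro j j' hjj
    have h1 : q ^ (j : ℕ) % (k * l) = q ^ (j' : ℕ) % (k * l) := by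
      rw [hdiv j, hdiv j', Fin.mk.inj hjj]
    have h2 : (q : ZMod (k * l)) ^ (j : ℕ) = (q : ZMod (k * l)) ^ (j' : ℕ) := by
      exact_mod_cast (ZMod.natCast_eq_natCast_iff _ _ _).2 h1
    exact Fin.ext (pow_injOn_Iio_orderOf (by simp [hord]) (by simp [hord]) h2)
  obtain ⟨j, hj⟩ := Finite.surjective_of_injective hf i
  exact ⟨j, by rw [hdiv j, ← hj]⟩

theorem root_add_of_pow_eq {F : Type*} [Field F] [Fintype F] (m : ℕ) (a b : F) (j r : ℕ)
    (hr : Fintype.card F ^ j % m = r) :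
    (AdjoinRoot.root (X ^ m - C a) + AdjoinRoot.of (X ^ m - C a) b) ^ Fintype.card F ^ j =
      AdjoinRoot.mk (X ^ m - C a) (C (a ^ (Fintype.card F ^ j / m)) * X ^ r + C b) := by
  subst hr
  obtain ⟨p, hp⟩ := CharP.exists F
  obtain ⟨n, hprime, hn⟩ := FiniteField.card F p
  have : Fact p.Prime := ⟨hprime⟩
  have hX : AdjoinRoot.mk (X ^ m - C a) (X ^ m) = AdjoinRoot.mk (X ^ m - C a) (C a) := by
    rw [AdjoinRoot.mk_eq_mk]
  have hfrob : (X + C b : F[X]) ^ Fintype.card F ^ j =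
      X ^ Fintype.card F ^ j + C b := by
    have := add_pow_char_pow (X : F[X]) (C b) p (n * j)
    rwa [pow_mul, ← hn, ← C_pow, FiniteField.pow_card_pow] at this
  rw [← AdjoinRoot.mk_X, ← AdjoinRoot.mk_C, ← map_add, ← map_pow, hfrob, map_add, map_add]
  congr 1
  conv_lhs => rw [← Nat.div_add_mod (Fintype.card F ^ j) m]
  rw [pow_add, pow_mul, map_mul, map_pow, hX, ← map_pow, ← C_pow, ← map_mul]

theorem mk_injOn_natDegree_lt {F : Type*} [Field F] {f : F[X]} :
    Set.InjOn (AdjoinRoot.mk f) {P | P.natDegree < f.natDegree} := by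
  intro P hP Q hQ h
  rw [AdjoinRoot.mk_eq_mk] at h
  exact sub_eq_zero.1
    (eq_zero_of_dvd_of_natDegree_lt h ((natDegree_sub_le P Q).trans_lt (max_lt hP hQ)))

theorem isOfFinOrder_root_add_of {F : Type*} [Field F] [Finite F] {f : F[X]}
    (hirr : Irreducible f) (hf : 1 < f.natDegree) (b : F) :
    IsOfFinOrder (AdjoinRoot.root f + AdjoinRoot.of f b) := by
  have : Fact (Irreducible f) := ⟨hirr⟩
  have : Module.Finite F (AdjoinRoot f) := (AdjoinRoot.powerBasis hirr.ne_zero).finite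
  have : Finite (AdjoinRoot f) := Module.finite_of_finite F
  refine isOfFinOrder_iff_isUnit.2 (IsUnit.mk0 _ fun h0 => X_add_C_ne_zero b ?_)
  refine mk_injOn_natDegree_lt (f := f) ?_ ?_ ?_
  · simpa using hf
  · simpa using hf.pos
  · rw [map_add, AdjoinRoot.mk_X, AdjoinRoot.mk_C, map_zero, h0]

theorem natDegree_prod_binomial_pow_le {F ι : Type*} [Field F] (S : Finset ι) (e u : ι → ℕ)
    (c : ι → F) (b : F) :
    (∏ i ∈ S, (C (c i) * X ^ e i + C b) ^ u i).natDegree ≤ ∑ i ∈ S, e i * u i := by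
  refine (natDegree_prod_le _ _).trans (Finset.sum_le_sum fun i _ => ?_)
  refine (natDegree_pow_le_of_le (u i) ?_).trans_eq (mul_comm _ _)
  compute_degree

/-- Theorem 2 of the paper: the multiplicative order of `θ + b` in
`F_q[x]/⟨x^m − a⟩` is at least `|T|`, where
`T = {(u_0,…,u_{l−1}) ∈ ℤ^l : Σ (i·k+1)·u_i < m, 0 ≤ u_i ≤ p−1}`. -/
theorem order_of_theta_add_b_ge_card_T
    (p n q m k l : ℕ) (hp : p.Prime) (hp5 : 5 ≤ p) (hn : 0 < n) (hq : q = p ^ n)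
    (hk : 1 < k) (hkdvd : k ∣ q - 1) (hm : m = k * l) (hl : 1 ≤ l)
    (hord : orderOf (q : ZMod m) = l)
    (F : Type*) [Field F] [Fintype F] (hcard : Fintype.card F = q)
    (a : F) (ha : a ≠ 0) (hirr : Irreducible (X ^ m - C a))
    (b : F) (hb : b ≠ 0) :
    {u : Fin l → ℕ | (∀ i, u i ≤ p - 1) ∧
        ∑ i : Fin l, ((i : ℕ) * k + 1) * u i < m}.ncard ≤
      orderOf (AdjoinRoot.root (X ^ m - C a) + AdjoinRoot.of (X ^ m - C a) b) := by
  subst hm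
  have : Fact p.Prime := ⟨hp⟩
  have hchar : CharP F p := charP_of_card_eq_prime_pow (hcard.trans hq)
  have hm : 1 < k * l := by nlinarith
  have hdeg : (X ^ (k * l) - C a).natDegree = k * l := natDegree_X_pow_sub_C
  have hfin := isOfFinOrder_root_add_of hirr (hdeg.symm ▸ hm) b
  set g := AdjoinRoot.root (X ^ (k * l) - C a) + AdjoinRoot.of (X ^ (k * l) - C a) b
  choose j hj using exists_pow_mod_eq hk hkdvd (hq ▸ pow_pos hp.pos n) hl hord
  let c : Fin l → F := fun i => a ^ (q ^ j i / (k * l))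
  have hpow : ∀ u : Fin l → ℕ, g ^ (∑ i, q ^ j i * u i) = AdjoinRoot.mk (X ^ (k * l) - C a)
      (∏ i, (C (c i) * X ^ ((i : ℕ) * k + 1) + C b) ^ u i) := by
    intro u
    rw [← Finset.prod_pow_eq_pow_sum, map_prod]
    refine Finset.prod_congr rfl fun i _ => ?_
    subst hcard
    rw [pow_mul g, map_pow]
    exact congrArg (· ^ u i) (root_add_of_pow_eq _ a b (j i) _ (hj i))
  have hdegprod : ∀ u : Fin l → ℕ, ∑ i : Fin l, ((i : ℕ) * k + 1) * u i < k * l →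
      (∏ i, (C (c i) * X ^ ((i : ℕ) * k + 1) + C b) ^ u i).natDegree <
        (X ^ (k * l) - C a).natDegree := fun u hu =>
    (natDegree_prod_binomial_pow_le _ _ u c b).trans_lt (hdeg.symm ▸ hu)
  rw [← Set.ncard_Iio_nat (orderOf g)]
  refine Set.ncard_le_ncard_of_injOn (fun u => (∑ i, q ^ j i * u i) % orderOf g)
    (fun u _ => Nat.mod_lt _ hfin.orderOf_pos) ?_ (Set.finite_Iio _)
  rintro u ⟨hu, hu'⟩ v ⟨hv, hv'⟩ huv
  have heq : g ^ (∑ i, q ^ j i * u i) = g ^ (∑ i, q ^ j i * v i) :=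
    (pow_mod_orderOf g _).symm.trans ((congrArg (g ^ ·) huv).trans (pow_mod_orderOf g _))
  rw [hpow, hpow] at heq
  have hp_pos := hp.pos
  refine eq_of_prod_binomial_pow_eq (p := p) (e := fun i : Fin l => (i : ℕ) * k + 1)
    (fun i i' hi => ?_) (fun i => Nat.succ_pos _) (fun i => pow_ne_zero _ ha) hb
    (fun i => by have := hu i; omega) (fun i => by have := hv i; omega)
    (mk_injOn_natDegree_lt (hdegprod u hu') (hdegprod v hv') heq)
  exact Nat.succ_lt_succ (Nat.mul_lt_mul_of_pos_right hi (by omega))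
end

section
/- Let p ≥ 5 be a prime, k > 1 and l ≥ 1 integers with l ≥ p² + 1, and m = k·l. Let T be the set of integer vectors (u_0, …, u_{l−1}) such that 0 ≤ u_i ≤ p − 1 for all i and Σ_{i=0}^{l−1} (i·k + 1)·u_i < m. Then |T| ≥ (p(p−1)/(160(l−1)))^{√p} · exp(2.5·√((1 − 1/p)(l−1))). -/
open Finset in
theorem sum_Icc_ite_dvd (m n : ℕ) (h : ℕ → ℕ) :
    ∑ x ∈ Icc 1 n, (if m ∣ x then h (x / m) else 0) = ∑ d ∈ Icc 1 (n / m), h d := by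
  induction n with
  | zero => simp
  | succ n ih =>
    rw [sum_Icc_succ_top (by omega), ih, Nat.succ_div]
    split_ifs
    · rw [sum_Icc_succ_top (Nat.le_add_left 1 (n / m))]
    · simp

open Finset in
theorem sum_range_mul_sub_eq_sum_Icc {R : Type*} [Semiring R] (w a : ℕ → R) (n : ℕ) :
    ∑ j ∈ range n, w (n - j) * a j = ∑ x ∈ Icc 1 n, w x * a (n - x) := by
  refine sum_nbij' (fun j ↦ n - j) (fun x ↦ n - x) ?_ ?_ ?_ ?_ ?_
  · simp only [mem_range, mem_Icc]; omega
  · simp only [mem_range, mem_Icc]; omega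
  · simp only [mem_range]; omega
  · simp only [mem_Icc]; omega
  · intro j hj
    rw [Nat.sub_sub_self (mem_range.1 hj).le]

namespace Nat.Partition

open Finset

theorem sum_Icc_sum_ite_le_count {n : ℕ} (P : n.Partition) (M : ℕ) :
    ∑ m ∈ Icc 1 M, ∑ d ∈ Icc 1 (n / m), (if m ≤ P.parts.count d then d else 0) ≤ n := by
  calc ∑ m ∈ Icc 1 M, ∑ d ∈ Icc 1 (n / m), (if m ≤ P.parts.count d then d else 0)
      ≤ ∑ m ∈ Icc 1 M, ∑ d ∈ Icc 1 n, (if m ≤ P.parts.count d then d else 0) := by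
        gcongr
        exact Nat.div_le_self _ _
    _ = ∑ d ∈ Icc 1 n, ∑ m ∈ Icc 1 M, (if m ≤ P.parts.count d then d else 0) := sum_comm
    _ ≤ ∑ d ∈ Icc 1 n, P.parts.count d • d := by
        gcongr with d
        rw [← sum_filter, sum_const]
        gcongr
        calc _ ≤ #(Icc 1 (P.parts.count d)) := by
              apply card_le_card
              intro m
              simp only [mem_filter, mem_Icc]
              omega
          _ = _ := by simp
    _ = n := by
        rw [← sum_multiset_count_of_subset, P.parts_sum]
        intro d hd
        rw [Multiset.mem_toFinset] at hd
        exact mem_Icc.2 ⟨P.parts_pos hd, le_of_mem_parts hd⟩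

theorem card_restricted_sub_mul_le (q : ℕ → Prop) [DecidablePred q] {n m d : ℕ} (hd : 0 < d)
    (hq : q d) (h : m * d ≤ n) :
    #(restricted (n - m * d) q) ≤ #{P ∈ restricted n q | m ≤ P.parts.count d} := by
  refine card_le_card_of_injOn
    (fun P ↦ ⟨P.parts + Multiset.replicate m d, ?_, ?_⟩) ?_ ?_
  · intro i hi
    rcases Multiset.mem_add.1 hi with hi | hi
    · exact P.parts_pos hi
    · exact (Multiset.eq_of_mem_replicate hi) ▸ hd
  · simp [P.parts_sum, h]
  · intro P hP
    simp only [restricted, coe_filter, mem_filter, mem_univ, true_and, Set.mem_ofPred_eq] at hP ⊢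
    refine ⟨fun i hi ↦ ?_, by simp⟩
    rcases Multiset.mem_add.1 hi with hi | hi
    · exact hP i hi
    · exact (Multiset.eq_of_mem_replicate hi) ▸ hq
  · intro P _ Q _ hPQ
    simpa [Nat.Partition.ext_iff] using hPQ

/-- The sum of the divisors `d` of `x` satisfying `q` whose codivisor is at most `M`. -/
def truncatedDivisorSum (q : ℕ → Prop) [DecidablePred q] (M x : ℕ) : ℕ :=
  ∑ m ∈ Icc 1 M, if m ∣ x then (if q (x / m) then x / m else 0) else 0

theorem sum_Icc_truncatedDivisorSum (q : ℕ → Prop) [DecidablePred q] (M n : ℕ) :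
    ∑ x ∈ Icc 1 n, truncatedDivisorSum q M x =
      ∑ m ∈ Icc 1 M, ∑ d ∈ Icc 1 (n / m), if q d then d else 0 := by
  unfold truncatedDivisorSum
  rw [sum_comm]
  exact sum_congr rfl fun m _ ↦ sum_Icc_ite_dvd m n fun d ↦ if q d then d else 0

theorem sum_truncatedDivisorSum_mul_card_restricted_le (q : ℕ → Prop) [DecidablePred q]
    (M n : ℕ) :
    ∑ j ∈ range n, truncatedDivisorSum q M (n - j) * #(restricted j q) ≤
      n * #(restricted n q) := by
  calc ∑ j ∈ range n, truncatedDivisorSum q M (n - j) * #(restricted j q)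
      = ∑ x ∈ Icc 1 n, truncatedDivisorSum q M x * #(restricted (n - x) q) :=
        sum_range_mul_sub_eq_sum_Icc _ (fun j ↦ #(restricted j q)) n
    _ = ∑ m ∈ Icc 1 M, ∑ x ∈ Icc 1 n, if m ∣ x then
          (if q (x / m) then x / m else 0) * #(restricted (n - m * (x / m)) q) else 0 := by
        unfold truncatedDivisorSum
        simp_rw [sum_mul]
        rw [sum_comm]
        refine sum_congr rfl fun m _ ↦ sum_congr rfl fun x _ ↦ ?_
        by_cases hx : m ∣ x
        · rw [if_pos hx, if_pos hx, Nat.mul_div_cancel' hx]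
        · simp only [if_neg hx, zero_mul]
    _ = ∑ m ∈ Icc 1 M, ∑ d ∈ Icc 1 (n / m),
          (if q d then d else 0) * #(restricted (n - m * d) q) :=
        sum_congr rfl fun m _ ↦ sum_Icc_ite_dvd m n
          fun d ↦ (if q d then d else 0) * #(restricted (n - m * d) q)
    _ ≤ ∑ m ∈ Icc 1 M, ∑ d ∈ Icc 1 (n / m),
          ∑ P ∈ restricted n q, if m ≤ P.parts.count d then d else 0 := by
        refine sum_le_sum fun m _ ↦ sum_le_sum fun d hd ↦ ?_
        rw [mem_Icc] at hd
        split_ifs with hqd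
        · rw [← sum_filter, sum_const, smul_eq_mul, mul_comm]
          gcongr
          refine card_restricted_sub_mul_le q hd.1 hqd ?_
          exact (Nat.mul_le_mul_left m hd.2).trans (Nat.mul_div_le n m)
        · simp
    _ = ∑ P ∈ restricted n q, ∑ m ∈ Icc 1 M, ∑ d ∈ Icc 1 (n / m),
          if m ≤ P.parts.count d then d else 0 := by
        rw [sum_comm]
        refine sum_congr rfl fun m _ ↦ sum_comm
    _ ≤ ∑ P ∈ restricted n q, n := by
        gcongr with P
        exact P.sum_Icc_sum_ite_le_count M
    _ = n * #(restricted n q) := by rw [sum_const, smul_eq_mul, mul_comm]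

theorem sum_card_countRestricted_le_ncard {p k l : ℕ} (hp : 0 < p) (hk : 0 < k) :
    ∑ n ∈ range l, #(countRestricted n p) ≤
      {u : Fin l → ℕ | (∀ i, u i ≤ p - 1) ∧
        ∑ i : Fin l, ((i : ℕ) * k + 1) * u i < k * l}.ncard := by
  have hfin : {u : Fin l → ℕ | (∀ i, u i ≤ p - 1) ∧
      ∑ i : Fin l, ((i : ℕ) * k + 1) * u i < k * l}.Finite :=
    (Set.finite_Iic (fun _ : Fin l ↦ p - 1)).subset fun u hu ↦ hu.1
  rw [← Finset.card_sigma, Set.ncard_eq_toFinset_card _ hfin]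
  have hmult (x : Σ n : ℕ, n.Partition) (hx : x.1 < l) :
      ∑ i : Fin l, x.2.parts.count (i + 1 : ℕ) * (i + 1 : ℕ) = x.1 := by
    rw [Fin.sum_univ_eq_sum_range (fun i ↦ x.2.parts.count (i + 1) * (i + 1)) l]
    conv_rhs => rw [← x.2.parts_sum]
    rw [sum_multiset_count_of_subset x.2.parts (Icc 1 l), ← sum_image (g := (· + 1))
      (f := fun d ↦ x.2.parts.count d * d) (by simp)]
    · rw [range_eq_Ico, image_add_right_Ico]
      rfl
    · intro d hd
      rw [Multiset.mem_toFinset] at hd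
      exact mem_Icc.2 ⟨x.2.parts_pos hd, (le_of_mem_parts hd).trans hx.le⟩
  refine card_le_card_of_injOn (fun x i ↦ x.2.parts.count (i + 1 : ℕ)) ?_ ?_
  · rintro x hx
    simp only [coe_sigma, Set.mem_sigma_iff, coe_range, Set.mem_Iio, countRestricted,
      coe_filter, mem_univ, true_and, Set.mem_ofPred_eq, Set.Finite.coe_toFinset] at hx ⊢
    refine ⟨fun i ↦ ?_, ?_⟩
    · by_cases hi : (i + 1 : ℕ) ∈ x.2.parts
      · have := hx.2 _ hi
        omega
      · simp [Multiset.count_eq_zero_of_notMem hi]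
    · calc ∑ i : Fin l, ((i : ℕ) * k + 1) * x.2.parts.count (i + 1 : ℕ)
          ≤ ∑ i : Fin l, k * (x.2.parts.count (i + 1 : ℕ) * (i + 1 : ℕ)) := by
            refine sum_le_sum fun i _ ↦ ?_
            calc ((i : ℕ) * k + 1) * x.2.parts.count (i + 1 : ℕ)
                ≤ (i * k + k) * x.2.parts.count (i + 1 : ℕ) := by gcongr; omega
              _ = _ := by ring
        _ = k * x.1 := by rw [← mul_sum, hmult x hx.1]
        _ < k * l := by gcongr; exact hx.1
  · rintro x hx y hy hxy
    simp only [coe_sigma, Set.mem_sigma_iff, coe_range, Set.mem_Iio] at hx hy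
    have hcount (i : Fin l) : x.2.parts.count (i + 1 : ℕ) = y.2.parts.count (i + 1 : ℕ) :=
      congrFun hxy i
    have h1 : x.1 = y.1 := by
      rw [← hmult x hx.1, ← hmult y hy.1]
      simp_rw [hcount]
    obtain ⟨n, P⟩ := x
    obtain ⟨n', Q⟩ := y
    obtain rfl : n = n' := h1
    congr 1
    ext d
    rcases Nat.eq_zero_or_pos d with rfl | hd
    · rw [Multiset.count_eq_zero_of_notMem fun h ↦ (P.parts_pos h).ne rfl,
        Multiset.count_eq_zero_of_notMem fun h ↦ (Q.parts_pos h).ne rfl]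
    · by_cases hdl : d ≤ l
      · simpa [Nat.sub_add_cancel hd] using hcount ⟨d - 1, by omega⟩
      · have hn := hx.1
        rw [Multiset.count_eq_zero_of_notMem fun h ↦ hdl ((le_of_mem_parts h).trans hn.le),
          Multiset.count_eq_zero_of_notMem fun h ↦ hdl ((le_of_mem_parts h).trans hn.le)]

end Nat.Partition
open Finset in
theorem sum_Icc_ite_not_dvd_lower {p : ℕ} (hp : 0 < p) (y : ℕ) :
    (1 - 1 / (p : ℝ)) * (y : ℝ) ^ 2 ≤ 2 * ∑ d ∈ Icc 1 y, if ¬ p ∣ d then (d : ℝ) else 0 := by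
  have hsum (y : ℕ) : 2 * ∑ d ∈ Icc 1 y, (if ¬ p ∣ d then (d : ℝ) else 0) =
      y * (y + 1) - p * ((y / p : ℕ) * ((y / p : ℕ) + 1)) := by
    induction y with
    | zero => simp
    | succ y ih =>
      rw [sum_Icc_succ_top (by omega), mul_add, ih, Nat.succ_div]
      split_ifs with h
      · have h1 : ((y + 1 : ℕ) : ℝ) = p * ((y / p : ℕ) + 1 : ℝ) := by
          have := Nat.mul_div_cancel' h
          rw [Nat.succ_div, if_pos h] at this
          exact_mod_cast this.symm
        push_cast at h1 ⊢
        linear_combination (-2 : ℝ) * h1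
      · push_cast
        ring
  rw [hsum]
  have hp' : (0 : ℝ) < p := by exact_mod_cast hp
  have h : (p : ℝ) * (y / p : ℕ) ≤ y := by exact_mod_cast Nat.mul_div_le y p
  have h2 : ((y / p : ℕ) : ℝ) ≤ y / p := by rw [le_div_iff₀' hp']; exact h
  have h3 : (p : ℝ) * ((y / p : ℕ) * ((y / p : ℕ) + 1)) ≤ y * (y / p + 1) := by
    rw [← mul_assoc]
    gcongr
  calc (1 - 1 / (p : ℝ)) * (y : ℝ) ^ 2 = y * (y + 1) - y * (y / p + 1) := by ring
    _ ≤ _ := by linarith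

open Finset in
theorem sum_sq_div_lower (n : ℕ) :
    25 * (n * (n + 1)) ≤ 16 * ∑ m ∈ Icc 1 24, (n / m) ^ 2 + 64 * n := by
  by_cases hn : n < 60
  · revert hn
    revert n
    decide +kernel
  · have key (m : ℕ) (hm : m ∈ Icc 1 24) :
        (n : ℝ) ^ 2 * (1 / (m : ℝ) ^ 2) - 2 * n * (1 / m - 1 / (m : ℝ) ^ 2) ≤
          ((n / m : ℕ) : ℝ) ^ 2 := by
      have hm0 : (0 : ℝ) < m := by exact_mod_cast (mem_Icc.1 hm).1
      have hmod : (m : ℝ) * (n / m : ℕ) + (n % m : ℕ) = n := by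
        exact_mod_cast Nat.div_add_mod n m
      have hlt : ((n % m : ℕ) : ℝ) + 1 ≤ m := by
        exact_mod_cast Nat.mod_lt n (mem_Icc.1 hm).1
      rw [← sub_nonneg]
      have : (((n / m : ℕ) : ℝ) ^ 2 -
          ((n : ℝ) ^ 2 * (1 / (m : ℝ) ^ 2) - 2 * n * (1 / m - 1 / (m : ℝ) ^ 2))) =
          ((n % m : ℕ) ^ 2 + 2 * n * (m - 1 - (n % m : ℕ))) / m ^ 2 := by
        field_simp
        have h2 : (m : ℝ) * (n / m : ℕ) = n - (n % m : ℕ) := by linarith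
        rw [← mul_pow, mul_comm _ (m : ℝ), h2]
        ring
      rw [this]
      have : (0 : ℝ) ≤ m - 1 - (n % m : ℕ) := by linarith
      positivity
    have hsum := sum_le_sum key
    rw [sum_sub_distrib, ← mul_sum, ← mul_sum, sum_sub_distrib] at hsum
    have h1 : ∑ m ∈ Icc (1 : ℕ) 24, 1 / (m : ℝ) ^ 2 ≥ 1.604 := by
      norm_num [sum_Icc_succ_top]
    have h2 : ∑ m ∈ Icc (1 : ℕ) 24, 1 / (m : ℝ) - ∑ m ∈ Icc (1 : ℕ) 24, 1 / (m : ℝ) ^ 2 ≤ 2.18 := by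
      norm_num [sum_Icc_succ_top]
    have hn' : (60 : ℝ) ≤ n := by exact_mod_cast not_lt.1 hn
    have : (25 * (n * (n + 1)) : ℝ) ≤ 16 * ∑ m ∈ Icc 1 24, ((n / m : ℕ) : ℝ) ^ 2 + 64 * n := by
      have h3 : (n : ℝ) ^ 2 * 1.604 ≤ n ^ 2 * ∑ m ∈ Icc (1 : ℕ) 24, 1 / (m : ℝ) ^ 2 := by gcongr
      have h4 : 2 * (n : ℝ) * (∑ m ∈ Icc (1 : ℕ) 24, 1 / (m : ℝ) -
          ∑ m ∈ Icc (1 : ℕ) 24, 1 / (m : ℝ) ^ 2) ≤ 2 * n * 2.18 := by gcongr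
      nlinarith
    exact_mod_cast this

open Finset in
theorem sum_range_mul_nonneg_of_sum_Icc_nonneg {v : ℕ → ℝ} (hv : ∀ n, 0 ≤ ∑ x ∈ Icc 1 n, v x)
    {a : ℕ → ℝ} (ha : Monotone a) (ha0 : 0 ≤ a 0) (n : ℕ) :
    0 ≤ ∑ j ∈ range n, v (n - j) * a j := by
  induction n generalizing a with
  | zero => simp
  | succ n ih =>
    have h := ih (a := fun j ↦ a (j + 1) - a 0)
      (fun i j hij ↦ by simpa using ha (by omega)) (by simpa using ha (Nat.zero_le _))
    have hs : ∑ j ∈ range n, v (n - j) = ∑ x ∈ Icc 1 n, v x := by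
      rw [← sum_range_reflect, ← Ico_add_one_right_eq_Icc, sum_Ico_eq_sum_range]
      refine sum_congr (by simp) fun j hj ↦ ?_
      rw [mem_range] at hj
      congr 1
      omega
    rw [sum_range_succ']
    simp only [Nat.add_sub_add_right, Nat.sub_zero]
    simp only [mul_sub, sum_sub_distrib, ← sum_mul, hs] at h
    have h2 := mul_nonneg (hv (n + 1)) ha0
    rw [sum_Icc_succ_top (by omega)] at h2
    linarith

open Finset in
theorem sum_range_add_one_mul_partialSum_le {w a : ℕ → ℝ}
    (h : ∀ n, ∑ j ∈ range n, w (n - j) * a j ≤ n * a n) (n : ℕ) :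
    ∑ j ∈ range n, (w (n - j) + 1) * ∑ i ∈ range (j + 1), a i ≤
      n * ∑ i ∈ range (n + 1), a i := by
  induction n with
  | zero => simp
  | succ n ih =>
    have h1 := h (n + 1)
    have h2 : ∑ j ∈ range (n + 1), (w (n + 1 - j) + 1) * ∑ i ∈ range (j + 1), a i =
        ∑ j ∈ range n, (w (n - j) + 1) * ∑ i ∈ range (j + 1), a i +
          ∑ j ∈ range (n + 1), w (n + 1 - j) * a j + ∑ i ∈ range (n + 1), a i := by
      have h3 : ∑ j ∈ range (n + 1), (w (n + 1 - j) + 1) * ∑ i ∈ range (j + 1), a i =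
          ∑ j ∈ range (n + 1), (w (n + 1 - j) + 1) * ∑ i ∈ range j, a i +
          ∑ j ∈ range (n + 1), (w (n + 1 - j) * a j + a j) := by
        rw [← sum_add_distrib]
        refine sum_congr rfl fun j _ ↦ ?_
        rw [sum_range_succ]
        ring
      rw [h3, sum_range_succ', sum_add_distrib]
      simp only [Nat.add_sub_add_right, range_zero, sum_empty, mul_zero, add_zero]
      ring
    rw [h2, sum_range_succ _ (n + 1)]
    push_cast at h1 ⊢
    linarith

open Finset in
theorem le_of_convolution_linear_le {C : ℝ} (hC : 0 ≤ C) {a g : ℕ → ℝ}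
    (h0 : g 0 ≤ a 0)
    (ha : ∀ n, ∑ j ∈ range n, C * ((n - j : ℕ) : ℝ) * a j ≤ n * a n)
    (h1 : g 1 ≤ C * g 0)
    (hg : ∀ n : ℕ, ((n : ℝ) + 2) * g (n + 2) + n * g n ≤ (2 * (n + 1) + C) * g (n + 1)) (n : ℕ) :
    g n ≤ a n := by
  have hrec (n : ℕ) : ∑ j ∈ range (n + 1), C * ((n + 1 - j : ℕ) : ℝ) * g j =
      ∑ j ∈ range n, C * ((n - j : ℕ) : ℝ) * g j + C * ∑ j ∈ range (n + 1), g j := by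
    rw [mul_sum, sum_range_succ, sum_range_succ _ n, ← add_assoc, ← sum_add_distrib]
    congr 1
    · refine sum_congr rfl fun j hj ↦ ?_
      rw [Nat.succ_sub (mem_range.1 hj).le]
      push_cast
      ring
    · simp
  have hdiff (n : ℕ) : ((n : ℝ) + 1) * g (n + 1) - n * g n ≤ C * ∑ j ∈ range (n + 1), g j := by
    induction n with
    | zero => simpa using h1
    | succ n ih =>
      have := hg n
      rw [sum_range_succ]
      push_cast
      linarith
  have hsub (n : ℕ) : n * g n ≤ ∑ j ∈ range n, C * ((n - j : ℕ) : ℝ) * g j := by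
    induction n with
    | zero => simp
    | succ n ih =>
      have := hdiff n
      rw [hrec]
      push_cast
      linarith
  induction n using Nat.strong_induction_on with
  | _ n ih =>
    rcases Nat.eq_zero_or_pos n with rfl | hn
    · exact h0
    · have h2 : ∑ j ∈ range n, C * ((n - j : ℕ) : ℝ) * g j ≤
          ∑ j ∈ range n, C * ((n - j : ℕ) : ℝ) * a j := by
        gcongr with j hj
        exact ih j (mem_range.1 hj)
      have hn' : (0 : ℝ) < n := by exact_mod_cast hn
      exact le_of_mul_le_mul_left ((hsub n).trans (h2.trans (ha n))) hn'

theorem exp_sub_cube_add_exp_neg_le {z : ℝ} (hz0 : 0 ≤ z) (hz : z ≤ 9 / 10) :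
    Real.exp (z - 2 / 25 * z ^ 3) + Real.exp (-z) ≤ 2 + z ^ 2 := by
  have hz3 : z ^ 3 ≤ z := by nlinarith [mul_nonneg hz0 hz0]
  set w := z - 2 / 25 * z ^ 3 with hw
  have hz3' : 0 ≤ z ^ 3 := by positivity
  have hw0 : 0 ≤ w := by linarith
  have hwz : w ≤ z := by linarith
  have h1 := Real.exp_bound' hw0 (by linarith) (n := 4) (by norm_num)
  have h2 := (abs_le.1 (Real.exp_bound (x := -z) (by rw [abs_neg, abs_of_nonneg hz0]; linarith)
    (n := 4) (by norm_num))).2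
  rw [abs_neg, abs_of_nonneg hz0] at h2
  norm_num [Finset.sum_range_succ, Nat.factorial] at h1 h2
  have h3 : w ^ 3 ≤ z ^ 3 := by gcongr
  have h4 : w ^ 4 ≤ z ^ 4 := by gcongr
  have h5 : w ^ 2 = z ^ 2 - 4 / 25 * z ^ 4 + 4 / 625 * z ^ 6 := by rw [hw]; ring
  have h6 : z ^ 4 ≤ 9 / 10 * z ^ 3 := by nlinarith
  have h7 : z ^ 6 ≤ z ^ 3 := by
    rw [show z ^ 6 = z ^ 3 * z ^ 3 by ring]
    nlinarith
  have h8 : 0 ≤ z ^ 4 := by positivity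
  nlinarith

theorem exp_mul_sqrt_add_one_add_exp_mul_sqrt_sub_one_le {κ x : ℝ} (hκ0 : 0 ≤ κ)
    (hκ : κ ≤ 5 / 2) (hx : 2 ≤ x) :
    Real.exp (κ * √(x + 1)) + Real.exp (κ * √(x - 1)) ≤
      (2 + κ ^ 2 / (4 * x)) * Real.exp (κ * √x) := by
  set s := √x with hs
  have hs2 : s ^ 2 = x := Real.sq_sqrt (by linarith)
  have hs0 : 1.4 ≤ s := Real.le_sqrt_of_sq_le (by linarith)
  have hspos : 0 < s := by linarith
  set y := 1 / (2 * s) with hy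
  have hsy : s * y = 1 / 2 := by rw [hy]; field_simp
  have hy0 : 0 ≤ y := by positivity
  have hy1 : y ≤ 0.36 := by
    rw [hy, div_le_iff₀ (by positivity)]
    linarith
  have hplus : √(x + 1) ≤ s + y - y ^ 3 / 2 := by
    refine Real.sqrt_le_iff.2 ⟨?_, ?_⟩
    · nlinarith [mul_nonneg hy0 hy0]
    · have : (s + y - y ^ 3 / 2) ^ 2 =
          s ^ 2 + 2 * (s * y) + y ^ 2 * (1 - s * y) - y ^ 4 + y ^ 6 / 4 := by ring
      rw [this, hsy, hs2]
      have h4 : y ^ 4 ≤ y ^ 2 / 2 := by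
        have : y ^ 2 ≤ 1 / 2 := by nlinarith
        calc y ^ 4 = y ^ 2 * y ^ 2 := by ring
          _ ≤ y ^ 2 * (1 / 2) := by gcongr
          _ = y ^ 2 / 2 := by ring
      have h6 : 0 ≤ y ^ 6 := by positivity
      linarith
  have hminus : √(x - 1) ≤ s - y := by
    refine Real.sqrt_le_iff.2 ⟨by linarith, ?_⟩
    rw [show (s - y) ^ 2 = s ^ 2 - 2 * (s * y) + y ^ 2 by ring, hsy, hs2]
    linarith [sq_nonneg y]
  have hz := exp_sub_cube_add_exp_neg_le (z := κ * y) (by positivity)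
    ((mul_le_mul hκ hy1 hy0 (by norm_num)).trans (by norm_num))
  have hz2 : (κ * y) ^ 2 = κ ^ 2 / (4 * x) := by
    rw [hy, ← hs2]
    field_simp
    norm_num
  have hcube : κ * (s + y - y ^ 3 / 2) ≤ (κ * y - 2 / 25 * (κ * y) ^ 3) + κ * s := by
    have h : 0 ≤ (κ * y ^ 3) * (1 / 2 - 2 / 25 * κ ^ 2) :=
      mul_nonneg (by positivity) (by nlinarith)
    linarith
  calc Real.exp (κ * √(x + 1)) + Real.exp (κ * √(x - 1))
      ≤ Real.exp ((κ * y - 2 / 25 * (κ * y) ^ 3) + κ * s) + Real.exp (-(κ * y) + κ * s) := by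
        gcongr
        · exact (mul_le_mul_of_nonneg_left hplus hκ0).trans hcube
        · exact (mul_le_mul_of_nonneg_left hminus hκ0).trans_eq (by ring)
    _ = (Real.exp (κ * y - 2 / 25 * (κ * y) ^ 3) + Real.exp (-(κ * y))) * Real.exp (κ * s) := by
        rw [Real.exp_add, Real.exp_add, add_mul]
    _ ≤ _ := by
        rw [← hz2]
        gcongr

theorem exp_mul_sqrt_two_le {κ : ℝ} (hκ0 : 0 ≤ κ) (hκ : κ ≤ 5 / 2) (hκ5 : 5 ≤ κ ^ 2) :
    Real.exp (κ * √2) ≤ (2 + κ ^ 2 / 4) * Real.exp κ := by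
  have h2 : √2 ≤ 1.415 := Real.sqrt_le_iff.2 (by norm_num)
  have h3 : Real.exp 0.0375 ≤ 1.04 :=
    (Real.exp_bound_div_one_sub_of_interval (by norm_num) (by norm_num)).trans (by norm_num)
  calc Real.exp (κ * √2) ≤ Real.exp (0.0375 + 1 + κ) := by
        gcongr
        nlinarith
    _ = Real.exp 0.0375 * Real.exp 1 * Real.exp κ := by rw [Real.exp_add, Real.exp_add]
    _ ≤ (2 + κ ^ 2 / 4) * Real.exp κ := by
        gcongr
        have : Real.exp 0.0375 * Real.exp 1 ≤ 1.04 * 3 :=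
          mul_le_mul h3 Real.exp_one_lt_three.le (by positivity) (by norm_num)
        linarith

theorem exp_five_halves_le : Real.exp (5 / 2) ≤ 12.5 := by
  refine le_of_sq_le_sq ?_ (by norm_num)
  rw [← Real.exp_nat_mul]
  calc Real.exp ((2 : ℕ) * (5 / 2)) = Real.exp 1 ^ 5 := by
        rw [← Real.exp_nat_mul]
        norm_num
    _ ≤ 2.7182818286 ^ 5 := by
        gcongr
        exact Real.exp_one_lt_d9.le
    _ ≤ 12.5 ^ 2 := by norm_num

open Finset in
theorem exp_mul_sqrt_div_le_of_convolution {κ : ℝ} (hκ0 : 0 ≤ κ) (hκ : κ ≤ 5 / 2)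
    (hκ5 : 5 ≤ κ ^ 2) {a : ℕ → ℝ} (h0 : 1 ≤ a 0)
    (ha : ∀ n, ∑ j ∈ range n, κ ^ 2 / 4 * ((n - j : ℕ) : ℝ) * a j ≤ n * a n)
    {n : ℕ} (hn : 0 < n) : Real.exp (κ * √n) / (10 * n) ≤ a n := by
  have h := le_of_convolution_linear_le (C := κ ^ 2 / 4) (by positivity) (a := a)
    (g := fun n ↦ if n = 0 then 1 else Real.exp (κ * √n) / (10 * n)) h0 ha ?_ ?_ n
  · simpa [hn.ne'] using h
  · have : Real.exp κ ≤ 12.5 := (Real.exp_le_exp.2 hκ).trans exp_five_halves_le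
    norm_num
    linarith
  · intro n
    rcases Nat.eq_zero_or_pos n with rfl | hn
    · have := exp_mul_sqrt_two_le hκ0 hκ hκ5
      norm_num
      linarith
    · have hn' : (1 : ℝ) ≤ n := by exact_mod_cast hn
      have h := exp_mul_sqrt_add_one_add_exp_mul_sqrt_sub_one_le hκ0 hκ (x := n + 1) (by linarith)
      rw [show (n : ℝ) + 1 + 1 = n + 2 by ring, show (n : ℝ) + 1 - 1 = n by ring] at h
      simp only [Nat.add_eq_zero_iff, hn.ne', OfNat.ofNat_ne_zero, one_ne_zero, and_false,
        if_false]
      push_cast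
      calc ((n : ℝ) + 2) * (Real.exp (κ * √(n + 2)) / (10 * (n + 2))) +
            n * (Real.exp (κ * √n) / (10 * n))
          = (Real.exp (κ * √(n + 2)) + Real.exp (κ * √n)) / 10 := by field_simp
        _ ≤ (2 + κ ^ 2 / (4 * (n + 1))) * Real.exp (κ * √(n + 1)) / 10 := by gcongr
        _ = _ := by field_simp

theorem ten_mul_pow_four_le_rpow_sqrt {x : ℝ} (hx : 5 ≤ x) :
    10.4 * x ^ 4 ≤ (160 : ℝ) ^ √x := by
  set s := √x with hs
  have hs2 : s ^ 2 = x := Real.sq_sqrt (by linarith)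
  have hs0 : 0 ≤ s := Real.sqrt_nonneg x
  have h5 : Real.exp 5 ≤ 160 := by
    calc Real.exp 5 = Real.exp (5 / 2) ^ 2 := by
          rw [← Real.exp_nat_mul]
          norm_num
      _ ≤ 12.5 ^ 2 := by
          gcongr
          exact exp_five_halves_le
      _ ≤ 160 := by norm_num
  have hlin : 1.35 * s ≤ Real.exp (5 * s / 8) := by
    have := Real.quadratic_le_exp_of_nonneg (x := 5 * s / 8) (by positivity)
    nlinarith [sq_nonneg (s - 1.856)]
  calc 10.4 * x ^ 4 ≤ (1.35 * s) ^ 8 := by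
        rw [mul_pow, show s ^ 8 = (s ^ 2) ^ 4 by ring, hs2]
        gcongr
        norm_num
    _ ≤ Real.exp (5 * s / 8) ^ 8 := by gcongr
    _ = Real.exp 5 ^ s := by
        rw [← Real.exp_nat_mul, ← Real.exp_mul]
        congr 1
        push_cast
        ring
    _ ≤ 160 ^ s := by gcongr

theorem rpow_sqrt_mul_le_one {x N : ℝ} (hx : 5 ≤ x) (hN : x ^ 2 ≤ N) :
    (x * (x - 1) / (160 * N)) ^ √x * (10 * N * (N + 1)) ≤ 1 := by
  have hN25 : 25 ≤ N := by nlinarith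
  have hN0 : 0 < N := by linarith
  have hs : 2 ≤ √x := Real.le_sqrt_of_sq_le (by linarith)
  have h160 := ten_mul_pow_four_le_rpow_sqrt hx
  have hx4 : 0 < 10.4 * x ^ 4 := by positivity
  calc (x * (x - 1) / (160 * N)) ^ √x * (10 * N * (N + 1))
      ≤ ((x ^ 2 / N) / 160) ^ √x * (10 * N * (N + 1)) := by
        rw [div_div, mul_comm N]
        gcongr
        · exact div_nonneg (mul_nonneg (by linarith) (by linarith)) (by positivity)
        · nlinarith
    _ = (x ^ 2 / N) ^ √x / 160 ^ √x * (10 * N * (N + 1)) := by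
        rw [Real.div_rpow (by positivity) (by norm_num)]
    _ ≤ (x ^ 2 / N) ^ (2 : ℝ) / (10.4 * x ^ 4) * (10 * N * (1.04 * N)) := by
        have hpow := Real.rpow_le_rpow_of_exponent_ge (by positivity)
          (div_le_one_of_le₀ hN hN0.le) hs
        have hN1 : N + 1 ≤ 1.04 * N := by linarith
        gcongr
    _ = 1 := by
        rw [Real.rpow_two]
        field_simp
        norm_num

namespace Nat.Partition

open Finset

theorem exp_mul_sqrt_div_le_sum_card_countRestricted {p : ℕ} (hp : 5 ≤ p) {N : ℕ} (hN : 0 < N) :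
    Real.exp (5 / 2 * √(1 - 1 / (p : ℝ)) * √N) / (10 * N * (N + 1)) ≤
      ∑ n ∈ range (N + 1), (#(countRestricted n p) : ℝ) := by
  have hp' : (5 : ℝ) ≤ p := by exact_mod_cast hp
  set r : ℝ := 1 - 1 / p with hr
  have hr1 : r ≤ 1 := by
    have : (0 : ℝ) ≤ 1 / p := by positivity
    linarith
  have hr0 : 4 / 5 ≤ r := by
    have : (1 : ℝ) / p ≤ 1 / 5 := by gcongr
    linarith
  have hκsq : (5 / 2 * √r) ^ 2 = 25 / 4 * r := by
    rw [mul_pow, Real.sq_sqrt (by linarith)]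
    norm_num
  let b (n : ℕ) : ℝ := #(restricted n (¬ p ∣ ·))
  let A (n : ℕ) : ℝ := ∑ i ∈ range (n + 1), b i
  let w (x : ℕ) : ℝ := truncatedDivisorSum (¬ p ∣ ·) 24 x
  have hb0 (n : ℕ) : 0 ≤ b n := Nat.cast_nonneg _
  have hA0 (n : ℕ) : 0 ≤ A n := sum_nonneg fun i _ ↦ hb0 i
  have hAmono : Monotone A := monotone_nat_of_le_succ fun n ↦ by
    simp only [A, sum_range_succ _ (n + 1), le_add_iff_nonneg_right, hb0]
  have hrec (n : ℕ) : ∑ j ∈ range n, w (n - j) * b j ≤ n * b n := by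
    have h := sum_truncatedDivisorSum_mul_card_restricted_le (¬ p ∣ ·) 24 n
    simpa only [Nat.cast_sum, Nat.cast_mul] using (Nat.cast_le (α := ℝ)).2 h
  have hrec2 := sum_range_add_one_mul_partialSum_le (w := fun x ↦ w x + 1) (a := A)
    (sum_range_add_one_mul_partialSum_le hrec)
  have hw (n : ℕ) : r * (∑ m ∈ Icc 1 24, ((n / m : ℕ) : ℝ) ^ 2) ≤ 2 * ∑ x ∈ Icc 1 n, w x := by
    have := sum_Icc_truncatedDivisorSum (¬ p ∣ ·) 24 n
    rw [← Nat.cast_sum, this, mul_sum]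
    push_cast
    rw [mul_sum]
    exact sum_le_sum fun m _ ↦ sum_Icc_ite_not_dvd_lower (by omega) (n / m)
  have hv (n : ℕ) : 0 ≤ ∑ x ∈ Icc 1 n, (w x + 1 + 1 - (5 / 2 * √r) ^ 2 / 4 * x) := by
    have hlin : ∑ x ∈ Icc 1 n, (x : ℝ) = n * (n + 1) / 2 := by
      induction n with
      | zero => simp
      | succ n ih =>
        rw [sum_Icc_succ_top (by omega), ih]
        push_cast
        ring
    have hsq : (25 * (n * (n + 1)) : ℝ) ≤
        16 * ∑ m ∈ Icc (1 : ℕ) 24, ((n / m : ℕ) : ℝ) ^ 2 + 64 * n := by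
      exact_mod_cast sum_sq_div_lower n
    rw [sum_sub_distrib, sum_add_distrib, sum_add_distrib, ← mul_sum, hlin, hκsq]
    simp only [sum_const, Nat.card_Icc, Nat.add_sub_cancel, nsmul_eq_mul, mul_one]
    have h1 := mul_le_mul_of_nonneg_left hsq (show 0 ≤ r by linarith)
    have h2 : r * n ≤ n := mul_le_of_le_one_left n.cast_nonneg hr1
    linarith [hw n]
  let A₂ (n : ℕ) : ℝ := ∑ i ∈ range (n + 1), A i
  have hconv (n : ℕ) :
      ∑ j ∈ range n, (5 / 2 * √r) ^ 2 / 4 * ((n - j : ℕ) : ℝ) * A₂ j ≤ n * A₂ n := by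
    refine le_trans ?_ (hrec2 n)
    have hmono : Monotone A₂ := monotone_nat_of_le_succ fun n ↦ by
      simp only [A₂, sum_range_succ _ (n + 1), le_add_iff_nonneg_right, hA0]
    have h := sum_range_mul_nonneg_of_sum_Icc_nonneg hv hmono
      (sum_nonneg fun i _ ↦ hA0 i) n
    simp only [sub_mul _ _ (A₂ _), sum_sub_distrib] at h
    exact sub_nonneg.1 h
  have hb1 : b 0 = 1 := by
    simp [b, restricted]
  have hmain := exp_mul_sqrt_div_le_of_convolution (κ := 5 / 2 * √r) (by positivity)
    (by linarith [Real.sqrt_le_one.2 hr1]) (by rw [hκsq]; linarith) (a := A₂)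
    (by simp [A₂, A, hb1]) hconv hN
  have hA₂ : A₂ N ≤ (N + 1) * A N := by
    calc A₂ N ≤ ∑ i ∈ range (N + 1), A N :=
          sum_le_sum fun i hi ↦ hAmono (by rw [mem_range] at hi; omega)
      _ = (N + 1) * A N := by simp
  have hAN : A N = ∑ n ∈ range (N + 1), (#(countRestricted n p) : ℝ) :=
    sum_congr rfl fun n _ ↦ by
      simp only [b, card_restricted_eq_card_countRestricted n (show 0 < p by omega)]
  rw [← hAN, ← div_div, div_le_iff₀ (by positivity), mul_comm (A N)]
  exact hmain.trans hA₂

end Nat.Partition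

/-- Item (i) of Theorem 2: if `l ≥ p² + 1`, then the set
`T = {(u_0,…,u_{l−1}) ∈ ℤ^l : Σ (i·k+1)·u_i < m, 0 ≤ u_i ≤ p−1}` (with `m = k·l`)
has cardinality at least
`(p(p−1)/(160(l−1)))^√p · exp(2.5·√((1 − 1/p)(l−1)))`. -/
theorem card_T_ge_of_l_large (p k l : ℕ) (hp : p.Prime) (hp5 : 5 ≤ p)
    (hk : 1 < k) (hl : p ^ 2 + 1 ≤ l) :
    ((p : ℝ) * ((p : ℝ) - 1) / (160 * ((l : ℝ) - 1))) ^ Real.sqrt (p : ℝ) *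
        Real.exp (2.5 * Real.sqrt ((1 - 1 / (p : ℝ)) * ((l : ℝ) - 1))) ≤
      ({u : Fin l → ℕ | (∀ i, u i ≤ p - 1) ∧
        ∑ i : Fin l, ((i : ℕ) * k + 1) * u i < k * l}.ncard : ℝ) := by
  obtain ⟨N, rfl⟩ : ∃ N, l = N + 1 := ⟨l - 1, by omega⟩
  have hN : 0 < N := lt_of_lt_of_le (pow_pos hp.pos 2) (by omega)
  have hp' : (5 : ℝ) ≤ p := by exact_mod_cast hp5
  have hN' : (p : ℝ) ^ 2 ≤ N := by exact_mod_cast Nat.le_of_succ_le_succ hl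
  have hN0 : (0 : ℝ) < N := by exact_mod_cast hN
  have hcard : ((∑ n ∈ Finset.range (N + 1), (Nat.Partition.countRestricted n p).card : ℕ) : ℝ) ≤
      ({u : Fin (N + 1) → ℕ | (∀ i, u i ≤ p - 1) ∧
        ∑ i : Fin (N + 1), ((i : ℕ) * k + 1) * u i < k * (N + 1)}.ncard : ℝ) := by
    exact_mod_cast Nat.Partition.sum_card_countRestricted_le_ncard hp.pos (by omega)
  refine le_trans ?_ hcard
  push_cast
  refine le_trans ?_ (Nat.Partition.exp_mul_sqrt_div_le_sum_card_countRestricted hp5 hN)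
  rw [add_sub_cancel_right, Real.sqrt_mul' _ hN0.le, ← mul_assoc,
    show (2.5 : ℝ) = 5 / 2 by norm_num, le_div_iff₀ (by positivity), mul_right_comm]
  exact mul_le_of_le_one_left (Real.exp_pos _).le (rpow_sqrt_mul_le_one hp' hN')
end

section
/- Let p ≥ 5 be a prime, k > 1 and l integers with 2 ≤ l < p + 1, and m = k·l. Let T be the set of integer vectors (u_0, …, u_{l−1}) such that 0 ≤ u_i ≤ p − 1 for all i and Σ_{i=0}^{l−1} (i·k + 1)·u_i < m. Then |T| ≥ exp(2.5·√(l−1)) / (13(l−1)). -/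
/-- The vectors `u ∈ ℕ^l` with `∑ (2i+1)·u_i = N`: partitions of `N` into odd parts below `2l`. -/
def oddPartitions (l N : ℕ) : Finset (Fin l → ℕ) :=
  {u ∈ Fintype.piFinset fun _ => Finset.range (N + 1) | ∑ i : Fin l, (2 * (i : ℕ) + 1) * u i = N}

theorem mem_oddPartitions {l N : ℕ} {u : Fin l → ℕ} :
    u ∈ oddPartitions l N ↔ ∑ i : Fin l, (2 * (i : ℕ) + 1) * u i = N := by
  refine ⟨fun h => (Finset.mem_filter.mp h).2, fun h => Finset.mem_filter.mpr ⟨?_, h⟩⟩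
  refine Fintype.mem_piFinset.mpr fun i => Finset.mem_range.mpr (Nat.lt_succ_of_le ?_)
  have h1 := Finset.single_le_sum (f := fun i : Fin l => (2 * (i : ℕ) + 1) * u i)
    (fun _ _ => Nat.zero_le _) (Finset.mem_univ i)
  rw [h] at h1
  exact (Nat.le_mul_of_pos_left _ (Nat.succ_pos _)).trans h1

theorem card_oddPartitions_zero_pos (l : ℕ) : 0 < (oddPartitions l 0).card :=
  Finset.card_pos.mpr ⟨0, mem_oddPartitions.mpr (by simp)⟩

/-- Adding copies of the part `2i+1` of total size `s`. -/
theorem card_oddPartitions_sub_le {l N s : ℕ} (hs : s ≤ N) (i : Fin l) (hi : 2 * (i : ℕ) + 1 ∣ s) :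
    (oddPartitions l (N - s)).card ≤
      {u ∈ oddPartitions l N | s ≤ (2 * (i : ℕ) + 1) * u i}.card := by
  obtain ⟨t, rfl⟩ := hi
  refine Finset.card_le_card_of_injOn (fun v => v + Pi.single i t) (fun v hv => ?_)
    (fun _ _ _ _ h => add_right_cancel h)
  have hv := mem_oddPartitions.mp hv
  refine Finset.mem_coe.mpr (Finset.mem_filter.mpr ⟨mem_oddPartitions.mpr ?_, ?_⟩)
  · have : ∑ j : Fin l, (2 * (j : ℕ) + 1) * (Pi.single i t : Fin l → ℕ) j
        = (2 * (i : ℕ) + 1) * t := by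
      rw [Finset.sum_eq_single i (fun j _ hj => by simp [hj]) (by simp)]
      simp
    simp only [Pi.add_apply, mul_add, Finset.sum_add_distrib, hv, this]
    omega
  · simp [mul_add]

/-- The part of the sum of the odd divisors of `s` coming from divisors `s / j` with `j ≤ 30`. -/
def oddSigma (s : ℕ) : ℕ :=
  ∑ j ∈ Finset.Icc 1 30, if j ∣ s ∧ Odd (s / j) then s / j else 0

theorem oddSigma_le_sum_odd_dvd {l s : ℕ} (hs : 0 < s) (hsl : s < 2 * l) :
    oddSigma s ≤ ∑ i : Fin l, if 2 * (i : ℕ) + 1 ∣ s then 2 * (i : ℕ) + 1 else 0 := by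
  calc oddSigma s
      = ∑ j ∈ Finset.Icc 1 30 with j ∣ s, if Odd (s / j) then s / j else 0 := by
        rw [oddSigma, Finset.sum_filter]
        exact Finset.sum_congr rfl fun j _ => by split_ifs <;> simp_all
    _ ≤ ∑ j ∈ s.divisors, if Odd (s / j) then s / j else 0 :=
        Finset.sum_le_sum_of_subset fun j hj =>
          Nat.mem_divisors.mpr ⟨(Finset.mem_filter.mp hj).2, hs.ne'⟩
    _ = ∑ d ∈ s.divisors, if Odd d then d else 0 :=
        Nat.sum_div_divisors s fun d => if Odd d then d else 0
    _ = ∑ d ∈ s.divisors with Odd d, d := (Finset.sum_filter _ _).symm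
    _ ≤ ∑ d ∈ {i ∈ Finset.range l | 2 * i + 1 ∣ s}.image fun i => 2 * i + 1, d := by
        refine Finset.sum_le_sum_of_subset fun d hd => ?_
        obtain ⟨hd, i, rfl⟩ := Finset.mem_filter.mp hd
        have hd := Nat.dvd_of_mem_divisors hd
        have := Nat.le_of_dvd hs hd
        exact Finset.mem_image.mpr
          ⟨i, Finset.mem_filter.mpr ⟨Finset.mem_range.mpr (by omega), hd⟩, rfl⟩
    _ = ∑ i : Fin l, if 2 * (i : ℕ) + 1 ∣ s then 2 * (i : ℕ) + 1 else 0 := by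
        rw [Finset.sum_image fun _ _ _ _ h => by simpa using h, Finset.sum_filter,
          Finset.sum_range fun i => if 2 * i + 1 ∣ s then 2 * i + 1 else 0]

theorem sum_multiples_le (N : ℕ) {w : ℕ} (hw : 0 < w) (a : ℕ) :
    ∑ s ∈ Finset.Icc 1 N, (if w ∣ s ∧ s ≤ w * a then w else 0) ≤ w * a := by
  rw [← Finset.sum_filter, Finset.sum_const, smul_eq_mul, mul_comm]
  refine Nat.mul_le_mul_left _ ?_
  calc _ ≤ (Finset.Icc 1 a).card := by
        refine Finset.card_le_card_of_injOn (fun s => s / w) (fun s hs => ?_) fun s hs t ht h => ?_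
        · obtain ⟨hs, ⟨b, rfl⟩, hb⟩ := Finset.mem_filter.mp hs
          have := (Finset.mem_Icc.mp hs).1
          have h1 : b ≤ a := Nat.le_of_mul_le_mul_left hb hw
          have h2 : 0 < b := Nat.pos_of_mul_pos_left this
          simp only [Nat.mul_div_cancel_left _ hw]
          exact Finset.mem_coe.mpr (Finset.mem_Icc.mpr ⟨h2, h1⟩)
        · obtain ⟨_, ⟨b, rfl⟩, _⟩ := Finset.mem_filter.mp hs
          obtain ⟨_, ⟨c, rfl⟩, _⟩ := Finset.mem_filter.mp ht
          simp only [Nat.mul_div_cancel_left _ hw] at h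
          rw [h]
    _ = a := by simp

theorem sum_oddSigma_mul_card_le {l N : ℕ} (hN : N < 2 * l) :
    ∑ s ∈ Finset.Icc 1 N, oddSigma s * (oddPartitions l (N - s)).card ≤
      N * (oddPartitions l N).card := by
  calc ∑ s ∈ Finset.Icc 1 N, oddSigma s * (oddPartitions l (N - s)).card
      ≤ ∑ s ∈ Finset.Icc 1 N, ∑ i : Fin l,
          (if 2 * (i : ℕ) + 1 ∣ s then 2 * (i : ℕ) + 1 else 0) *
            {u ∈ oddPartitions l N | s ≤ (2 * (i : ℕ) + 1) * u i}.card := by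
        refine Finset.sum_le_sum fun s hs => ?_
        obtain ⟨h1, h2⟩ := Finset.mem_Icc.mp hs
        refine (Nat.mul_le_mul_right _ (oddSigma_le_sum_odd_dvd h1 (h2.trans_lt hN))).trans ?_
        rw [Finset.sum_mul]
        refine Finset.sum_le_sum fun i _ => ?_
        split_ifs with h
        · exact Nat.mul_le_mul_left _ (card_oddPartitions_sub_le h2 i h)
        · simp
    _ = ∑ u ∈ oddPartitions l N, ∑ i : Fin l, ∑ s ∈ Finset.Icc 1 N,
          if 2 * (i : ℕ) + 1 ∣ s ∧ s ≤ (2 * (i : ℕ) + 1) * u i then 2 * (i : ℕ) + 1 else 0 := by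
        rw [Finset.sum_comm, Finset.sum_comm (s := oddPartitions l N)]
        refine Finset.sum_congr rfl fun i _ => ?_
        rw [Finset.sum_comm]
        refine Finset.sum_congr rfl fun s _ => ?_
        rw [Finset.card_filter, Finset.mul_sum]
        refine Finset.sum_congr rfl fun u _ => ?_
        split_ifs <;> simp_all
    _ ≤ ∑ u ∈ oddPartitions l N, ∑ i : Fin l, (2 * (i : ℕ) + 1) * u i :=
        Finset.sum_le_sum fun u _ => Finset.sum_le_sum fun i _ =>
          sum_multiples_le N (Nat.succ_pos _) _
    _ = N * (oddPartitions l N).card := by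
        rw [Finset.sum_congr rfl fun u hu => mem_oddPartitions.mp hu]
        simp [mul_comm]

theorem card_oddPartitions_le_ncard {p k l : ℕ} (hl : 0 < l) (hk : 1 < k) (hlp : l < p + 1) :
    (oddPartitions l (2 * l - 1)).card ≤
      {u : Fin l → ℕ | (∀ i, u i ≤ p - 1) ∧
        ∑ i : Fin l, ((i : ℕ) * k + 1) * u i < k * l}.ncard := by
  obtain _ | n := l
  · exact absurd hl (lt_irrefl 0)
  have hfin : {u : Fin (n + 1) → ℕ | (∀ i, u i ≤ p - 1) ∧
      ∑ i : Fin (n + 1), ((i : ℕ) * k + 1) * u i < k * (n + 1)}.Finite :=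
    (Set.finite_Iic fun _ => p - 1).subset fun u hu => hu.1
  rw [← Set.ncard_coe_finset]
  refine Set.ncard_le_ncard_of_injOn (fun u => Function.update u 0 0) (fun u hu => ?_)
    (fun u hu v hv h => ?_) hfin
  · have hu := mem_oddPartitions.mp hu
    rw [Fin.sum_univ_succ] at hu
    refine ⟨fun i => ?_, ?_⟩
    · obtain rfl | ⟨j, rfl⟩ := Fin.eq_zero_or_eq_succ i
      · simp
      · have h1 := Finset.single_le_sum
          (f := fun i : Fin n => (2 * (i.succ : ℕ) + 1) * u i.succ)
          (fun _ _ => Nat.zero_le _) (Finset.mem_univ j)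
        have h2 : 3 * u j.succ ≤ (2 * (j.succ : ℕ) + 1) * u j.succ :=
          Nat.mul_le_mul_right _ (by simp)
        simp only [Function.update_of_ne (Fin.succ_ne_zero j)]
        omega
    · have hsplit : ∑ i : Fin n, (2 * (i.succ : ℕ) + 1) * u i.succ
          = 2 * ∑ i : Fin n, (i.succ : ℕ) * u i.succ + ∑ i : Fin n, u i.succ := by
        rw [Finset.mul_sum, ← Finset.sum_add_distrib]
        exact Finset.sum_congr rfl fun i _ => by ring
      have hgoal : ∑ i : Fin (n + 1), ((i : ℕ) * k + 1) * Function.update u 0 0 i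
          = k * ∑ i : Fin n, (i.succ : ℕ) * u i.succ + ∑ i : Fin n, u i.succ := by
        rw [Fin.sum_univ_succ, Finset.mul_sum, ← Finset.sum_add_distrib]
        simp only [Function.update_self, mul_zero, zero_add]
        refine Finset.sum_congr rfl fun i _ => ?_
        rw [Function.update_of_ne (Fin.succ_ne_zero i)]
        ring
      rw [hgoal]
      rw [hsplit] at hu
      generalize ∑ i : Fin n, (i.succ : ℕ) * u i.succ = x at *
      generalize ∑ i : Fin n, u i.succ = y at *
      obtain ⟨z, hz⟩ : ∃ z, n = x + z := ⟨n - x, by omega⟩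
      subst hz
      have hy : y ≤ 2 * z + 1 := by simp at hu; omega
      nlinarith [Nat.mul_le_mul_right (z + 1) hk]
  · have hu := mem_oddPartitions.mp hu
    have hv := mem_oddPartitions.mp hv
    have hs : ∀ i : Fin n, u i.succ = v i.succ := fun i => by
      simpa [Function.update_of_ne (Fin.succ_ne_zero i)] using congrFun h i.succ
    rw [Fin.sum_univ_succ] at hu hv
    rw [Finset.sum_congr rfl fun i _ => by rw [hs i]] at hu
    funext i
    obtain rfl | ⟨j, rfl⟩ := Fin.eq_zero_or_eq_succ i
    · simp at hu hv
      omega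
    · exact hs j

theorem add_one_div_two_sq_succ (m : ℕ) :
    ((m + 1 + 1) / 2) ^ 2 = ((m + 1) / 2) ^ 2 + if Odd (m + 1) then m + 1 else 0 := by
  obtain ⟨t, rfl | rfl⟩ := Nat.even_or_odd' m
  · rw [if_pos ⟨t, rfl⟩, show (2 * t + 1 + 1) / 2 = t + 1 by omega,
      show (2 * t + 1) / 2 = t by omega]
    ring
  · rw [if_neg (Nat.not_odd_iff_even.mpr ⟨t + 1, by omega⟩),
      show (2 * t + 1 + 1 + 1) / 2 = t + 1 by omega,
      show (2 * t + 1 + 1) / 2 = t + 1 by omega, add_zero]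

theorem div_add_one_div_two_sq_succ (j n : ℕ) :
    (((n + 1) / j + 1) / 2) ^ 2 =
      ((n / j + 1) / 2) ^ 2 + if j ∣ n + 1 ∧ Odd ((n + 1) / j) then (n + 1) / j else 0 := by
  by_cases h : j ∣ n + 1
  · rw [Nat.succ_div_of_dvd h, add_one_div_two_sq_succ]
    simp only [h, true_and]
  · rw [Nat.succ_div_of_not_dvd h]
    simp [h]

/-- The sum of `oddSigma` over `0, …, n`. -/
def oddSigmaSum (n : ℕ) : ℕ := ∑ j ∈ Finset.Icc 1 30, ((n / j + 1) / 2) ^ 2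

theorem oddSigmaSum_succ (n : ℕ) :
    oddSigmaSum (n + 1) = oddSigmaSum n + oddSigma (n + 1) := by
  rw [oddSigmaSum, oddSigmaSum, oddSigma, ← Finset.sum_add_distrib]
  exact Finset.sum_congr rfl fun j _ => div_add_one_div_two_sq_succ j n

/-- The partial sums of `oddSigmaSum`. -/
def oddSigmaSum₂ : ℕ → ℕ
  | 0 => 0
  | n + 1 => oddSigmaSum₂ n + oddSigmaSum (n + 1)

/-- The partial sums of `oddSigmaSum₂`. -/
def oddSigmaSum₃ : ℕ → ℕ
  | 0 => 0
  | n + 1 => oddSigmaSum₃ n + oddSigmaSum₂ (n + 1)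

theorem oddSigmaSum_ge_of_ge {n : ℕ} (hn : 320 ≤ n) :
    79 / 100 * ((n : ℝ) * (n + 1) / 2) + (n + 1) ≤ oddSigmaSum n := by
  have key : ∀ j ∈ Finset.Icc 1 30,
      (((n : ℝ) + 1) / j - 1) ^ 2 / 4 ≤ (((n / j + 1) / 2 : ℕ) : ℝ) ^ 2 := fun j hj => by
    obtain ⟨h1, h2⟩ := Finset.mem_Icc.mp hj
    have hj0 : (0 : ℝ) < j := by exact_mod_cast h1
    have h3 : n + 1 ≤ j * (n / j) + j := by
      have := Nat.div_add_mod n j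
      have := Nat.mod_lt n h1
      omega
    have h4 : ((n : ℝ) + 1) ≤ j * ((n / j : ℕ) : ℝ) + j := by exact_mod_cast h3
    have h5 : ((n : ℝ) + 1) / j ≤ ((n / j : ℕ) : ℝ) + 1 := by
      rw [div_le_iff₀ hj0]; linarith
    have h6 : ((n / j : ℕ) : ℝ) ≤ 2 * (((n / j + 1) / 2 : ℕ) : ℝ) := by
      exact_mod_cast (by omega : n / j ≤ 2 * ((n / j + 1) / 2))
    have h7 : (1 : ℝ) ≤ ((n : ℝ) + 1) / j := by
      rw [le_div_iff₀ hj0, one_mul]; exact_mod_cast (by omega : j ≤ n + 1)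
    have := pow_le_pow_left₀ (by linarith : (0 : ℝ) ≤ ((n : ℝ) + 1) / j - 1)
      (by linarith : ((n : ℝ) + 1) / j - 1 ≤ 2 * (((n / j + 1) / 2 : ℕ) : ℝ)) 2
    linarith
  have hsum := Finset.sum_le_sum key
  have hn' : (320 : ℝ) ≤ n := by exact_mod_cast hn
  rw [oddSigmaSum]
  push_cast at hsum ⊢
  refine le_trans ?_ hsum
  simp only [Finset.sum_Icc_succ_top, Nat.one_le_ofNat, Nat.reduceAdd, Finset.Icc_self,
    Finset.sum_singleton]
  push_cast
  nlinarith

theorem oddSigmaSum_ge_of_lt :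
    ∀ n < 320, 45 ≤ n → 79 * (n * (n + 1)) ≤ 200 * oddSigmaSum n := by
  decide +kernel

theorem oddSigmaSum_ge_add_of_lt :
    ∀ n < 320, 165 ≤ n → 79 * (n * (n + 1)) + 200 * (n + 1) ≤ 200 * oddSigmaSum n := by
  decide +kernel

theorem oddSigmaSum₂_ge_of_lt :
    ∀ n < 46, 3 ≤ n → 79 * (n * (n + 1) * (n + 2)) ≤ 600 * oddSigmaSum₂ n := by
  decide +kernel

theorem low_order_ge_of_lt : ∀ n < 162, 5 ≤ n →
    144 * 79 * 100 ^ 3 * (n + 4) + 72 * 79 ^ 2 * 100 ^ 2 * ((n + 3) * (n + 4))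
        + 12 * 79 ^ 3 * 100 * ((n + 2) * (n + 3) * (n + 4))
        + 79 ^ 4 * ((n + 1) * (n + 2) * (n + 3) * (n + 4)) ≤
      144 * 100 ^ 4 * oddSigma (n + 4) + 144 * 79 * 100 ^ 3 * oddSigmaSum (n + 3)
        + 72 * 79 ^ 2 * 100 ^ 2 * oddSigmaSum₂ (n + 2)
        + 24 * 79 ^ 3 * 100 * oddSigmaSum₃ (n + 1) := by
  decide +kernel

/-- The coefficients of the power series `exp ((79 / 100) X / (1 - X))`. -/
noncomputable def expCoeff : ℕ → ℝ
  | 0 => 1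
  | 1 => 79 / 100
  | n + 2 => ((2 * n + 2 + 79 / 100) * expCoeff (n + 1) - n * expCoeff n) / (n + 2)

theorem expCoeff_rec (n : ℕ) :
    ((n : ℝ) + 2) * expCoeff (n + 2) =
      (2 * n + 2 + 79 / 100) * expCoeff (n + 1) - n * expCoeff n := by
  rw [expCoeff, mul_div_cancel₀ _ (by positivity)]

/-- The backward difference, i.e. multiplication of the generating function by `1 - X`. -/
def backwardDiff (a : ℕ → ℝ) : ℕ → ℝ
  | 0 => a 0
  | n + 1 => a (n + 1) - a n

open PowerSeries in
theorem mk_backwardDiff (a : ℕ → ℝ) : mk (backwardDiff a) = (1 - X) * mk a := by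
  ext n
  cases n with
  | zero => simp [backwardDiff, sub_mul]
  | succ n => simp [backwardDiff, sub_mul, coeff_succ_X_mul]

open PowerSeries in
theorem sum_antidiagonal_backwardDiff_mul (a b : ℕ → ℝ) (N : ℕ) :
    ∑ ij ∈ Finset.HasAntidiagonal.antidiagonal N, backwardDiff a ij.1 * b ij.2 =
      ∑ ij ∈ Finset.HasAntidiagonal.antidiagonal N, a ij.1 * backwardDiff b ij.2 := by
  have h : mk (backwardDiff a) * mk b = mk a * mk (backwardDiff b) := by
    rw [mk_backwardDiff, mk_backwardDiff]; ring
  simpa [coeff_mul] using congrArg (coeff N) h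

open PowerSeries in
theorem sum_antidiagonal_mul_expCoeff (N : ℕ) :
    79 / 100 * ∑ ij ∈ Finset.HasAntidiagonal.antidiagonal N, (ij.1 : ℝ) * expCoeff ij.2 =
      N * expCoeff N := by
  set f : ℕ → ℝ := fun n => n
  set g : ℕ → ℝ := fun n => n * expCoeff n
  have hf : (1 - X) ^ 2 * mk f = X := by
    rw [pow_two, mul_assoc, ← mk_backwardDiff, ← mk_backwardDiff]
    ext n
    rcases n with _ | _ | n
    · simp [backwardDiff, f]
    · simp [backwardDiff, f]
    · simp [backwardDiff, f, coeff_X]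
  have hg : (1 - X) ^ 2 * mk g = X * (C (79 / 100 : ℝ) * mk expCoeff) := by
    rw [pow_two, mul_assoc, ← mk_backwardDiff, ← mk_backwardDiff]
    ext n
    rcases n with _ | _ | n
    · simp [backwardDiff, g]
    · simp [backwardDiff, g, expCoeff, coeff_succ_X_mul]
    · have := expCoeff_rec n
      simp only [backwardDiff, g, coeff_succ_X_mul, coeff_mk, coeff_C_mul]
      push_cast
      linear_combination this
  have hX : ((1 - X) ^ 2 : PowerSeries ℝ) ≠ 0 := by
    intro h
    simpa using congrArg (coeff 0) h
  have h : C (79 / 100 : ℝ) * (mk f * mk expCoeff) = mk g := by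
    refine mul_left_cancel₀ hX ?_
    rw [hg]
    linear_combination (C (79 / 100 : ℝ) * mk expCoeff) * hf
  have := congrArg (coeff N) h
  rw [coeff_C_mul, coeff_mul] at this
  simpa only [coeff_mk] using this

/-- The coefficients of `(1 - X) ^ 3 exp ((79 / 100) X / (1 - X))`. -/
noncomputable def expCoeffDiff : ℕ → ℝ := backwardDiff (backwardDiff (backwardDiff expCoeff))

theorem expCoeffDiff_rec (n : ℕ) :
    ((n : ℝ) + 5) * expCoeffDiff (n + 5) =
      (2 * n + 5 + 79 / 100) * expCoeffDiff (n + 4) - n * expCoeffDiff (n + 3) := by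
  have h0 := expCoeff_rec n
  have h1 := expCoeff_rec (n + 1)
  have h2 := expCoeff_rec (n + 2)
  have h3 := expCoeff_rec (n + 3)
  rcases n with _ | n
  · simp only [expCoeffDiff, backwardDiff] at *
    push_cast at *
    linear_combination h3 - 3 * h2 + 3 * h1 - h0
  · simp only [expCoeffDiff, backwardDiff] at *
    push_cast at *
    linear_combination h3 - 3 * h2 + 3 * h1 - h0

theorem expCoeffDiff_nonneg_and_monotone (n : ℕ) :
    0 ≤ expCoeffDiff (n + 4) ∧ expCoeffDiff (n + 4) ≤ expCoeffDiff (n + 5) := by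
  induction n with
  | zero =>
    have h4 : 0 ≤ expCoeffDiff 4 := by
      norm_num [expCoeffDiff, backwardDiff, expCoeff]
    have := expCoeffDiff_rec 0
    norm_num at this ⊢
    exact ⟨h4, by linarith⟩
  | succ n ih =>
    have := expCoeffDiff_rec (n + 1)
    push_cast at this
    refine ⟨ih.1.trans ih.2, ?_⟩
    rw [show n + 1 + 4 = n + 5 by ring, show n + 1 + 3 = n + 4 by ring] at *
    rw [show n + 1 + 5 = n + 6 by ring] at *
    have hn : (0 : ℝ) ≤ n := n.cast_nonneg
    nlinarith [mul_le_mul_of_nonneg_left ih.2 hn]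

/-- The excess of `oddSigmaSum` over the partial sums of `79 / 100 * n`. -/
noncomputable def excess (n : ℕ) : ℝ := oddSigmaSum n - 79 / 100 * (n * (n + 1) / 2)

/-- The partial sums of `excess`. -/
noncomputable def excess₂ (n : ℕ) : ℝ :=
  oddSigmaSum₂ n - 79 / 100 * (n * (n + 1) * (n + 2) / 6)

/-- The partial sums of `excess₂`. -/
noncomputable def excess₃ (n : ℕ) : ℝ :=
  oddSigmaSum₃ n - 79 / 100 * (n * (n + 1) * (n + 2) * (n + 3) / 24)

theorem backwardDiff_excess :
    backwardDiff excess = fun n => (oddSigma n : ℝ) - 79 / 100 * n := by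
  funext n
  rcases n with _ | n
  · simp [backwardDiff, excess, oddSigmaSum, oddSigma]
  · simp only [backwardDiff, excess, oddSigmaSum_succ]
    push_cast
    ring

theorem backwardDiff_excess₂ : backwardDiff excess₂ = excess := by
  funext n
  rcases n with _ | n
  · simp [backwardDiff, excess, excess₂, oddSigmaSum, oddSigmaSum₂]
  · simp only [backwardDiff, excess, excess₂, oddSigmaSum₂]
    push_cast
    ring

theorem backwardDiff_excess₃ : backwardDiff excess₃ = excess₂ := by
  funext n
  rcases n with _ | n
  · simp [backwardDiff, excess₂, excess₃, oddSigmaSum₂, oddSigmaSum₃]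
  · simp only [backwardDiff, excess₂, excess₃, oddSigmaSum₃]
    push_cast
    ring

theorem excess_nonneg {n : ℕ} (hn : 45 ≤ n) : 0 ≤ excess n := by
  rw [excess]
  obtain h | h := lt_or_ge n 320
  · have : (79 * (n * (n + 1)) : ℝ) ≤ 200 * oddSigmaSum n := by
      exact_mod_cast oddSigmaSum_ge_of_lt n h hn
    linarith
  · have := oddSigmaSum_ge_of_ge h
    have : (0 : ℝ) ≤ n := n.cast_nonneg
    linarith

theorem add_one_le_excess {n : ℕ} (hn : 165 ≤ n) : (n : ℝ) + 1 ≤ excess n := by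
  rw [excess]
  obtain h | h := lt_or_ge n 320
  · have : (79 * (n * (n + 1)) + 200 * (n + 1) : ℝ) ≤ 200 * oddSigmaSum n := by
      exact_mod_cast oddSigmaSum_ge_add_of_lt n h hn
    linarith
  · linarith [oddSigmaSum_ge_of_ge h]

theorem excess₂_nonneg {n : ℕ} (hn : 3 ≤ n) : 0 ≤ excess₂ n := by
  induction n, hn using Nat.le_induction with
  | base =>
    have : (79 * (3 * (3 + 1) * (3 + 2)) : ℝ) ≤ 600 * oddSigmaSum₂ 3 := by
      exact_mod_cast oddSigmaSum₂_ge_of_lt 3 (by norm_num) le_rfl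
    rw [excess₂]
    push_cast
    linarith
  | succ n hn ih =>
    obtain h | h := lt_or_ge (n + 1) 46
    · have : (79 * (((n + 1 : ℕ) : ℝ) * ((n + 1 : ℕ) + 1) * ((n + 1 : ℕ) + 2)) : ℝ)
          ≤ 600 * oddSigmaSum₂ (n + 1) := by
        exact_mod_cast oddSigmaSum₂_ge_of_lt (n + 1) h (by omega)
      rw [excess₂]
      linarith
    · have h1 := congrFun backwardDiff_excess₂ (n + 1)
      have h2 := excess_nonneg (n := n + 1) (by omega)
      simp only [backwardDiff] at h1
      linarith

theorem oddSigmaSum₃_ge_of_lt :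
    ∀ n < 4, 79 * (n * (n + 1) * (n + 2) * (n + 3)) ≤ 2400 * oddSigmaSum₃ n := by
  decide +kernel

theorem excess₃_nonneg (n : ℕ) : 0 ≤ excess₃ n := by
  induction n with
  | zero => simp [excess₃]
  | succ n ih =>
    obtain h | h := lt_or_ge (n + 1) 4
    · have : (79 * (((n + 1 : ℕ) : ℝ) * ((n + 1 : ℕ) + 1) * ((n + 1 : ℕ) + 2)
          * ((n + 1 : ℕ) + 3)) : ℝ) ≤ 2400 * oddSigmaSum₃ (n + 1) := by
        exact_mod_cast oddSigmaSum₃_ge_of_lt (n + 1) h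
      rw [excess₃]
      linarith
    · have h1 := congrFun backwardDiff_excess₃ (n + 1)
      have h2 := excess₂_nonneg (n := n + 1) (by omega)
      simp only [backwardDiff] at h1
      linarith

theorem low_order_nonneg {n : ℕ} (hn : 5 ≤ n) :
    0 ≤ ((oddSigma (n + 4) : ℝ) - 79 / 100 * (n + 4)) + 79 / 100 * excess (n + 3)
      + (79 / 100) ^ 2 / 2 * excess₂ (n + 2) + (79 / 100) ^ 3 / 6 * excess₃ (n + 1) := by
  obtain h | h := lt_or_ge n 162
  · have : (144 * 79 * 100 ^ 3 * (n + 4) + 72 * 79 ^ 2 * 100 ^ 2 * ((n + 3) * (n + 4))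
        + 12 * 79 ^ 3 * 100 * ((n + 2) * (n + 3) * (n + 4))
        + 79 ^ 4 * ((n + 1) * (n + 2) * (n + 3) * (n + 4)) : ℝ) ≤
      144 * 100 ^ 4 * oddSigma (n + 4) + 144 * 79 * 100 ^ 3 * oddSigmaSum (n + 3)
        + 72 * 79 ^ 2 * 100 ^ 2 * oddSigmaSum₂ (n + 2)
        + 24 * 79 ^ 3 * 100 * oddSigmaSum₃ (n + 1) := by
      exact_mod_cast low_order_ge_of_lt n h hn
    simp only [excess, excess₂, excess₃]
    push_cast
    linarith
  · have h1 := add_one_le_excess (n := n + 3) (by omega)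
    have h2 := excess₂_nonneg (n := n + 2) (by omega)
    have h3 := excess₃_nonneg (n + 1)
    have h4 : (0 : ℝ) ≤ oddSigma (n + 4) := Nat.cast_nonneg _
    push_cast at h1
    linarith

theorem sum_antidiagonal_excess_mul (N : ℕ) :
    ∑ ij ∈ Finset.HasAntidiagonal.antidiagonal N,
        ((oddSigma ij.1 : ℝ) - 79 / 100 * ij.1) * expCoeff ij.2 =
      ∑ ij ∈ Finset.HasAntidiagonal.antidiagonal N, excess₃ ij.1 * expCoeffDiff ij.2 := by
  rw [expCoeffDiff, ← sum_antidiagonal_backwardDiff_mul, backwardDiff_excess₃,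
    ← sum_antidiagonal_backwardDiff_mul, backwardDiff_excess₂,
    ← sum_antidiagonal_backwardDiff_mul, backwardDiff_excess]

theorem mul_expCoeff_le_sum {N : ℕ} (hN : 9 ≤ N) :
    N * expCoeff N ≤
      ∑ ij ∈ Finset.HasAntidiagonal.antidiagonal N, (oddSigma ij.1 : ℝ) * expCoeff ij.2 := by
  rw [← sum_antidiagonal_mul_expCoeff, ← sub_nonneg, Finset.mul_sum, ← Finset.sum_sub_distrib]
  simp only [← mul_assoc, ← sub_mul]
  rw [sum_antidiagonal_excess_mul, ← Finset.Nat.sum_antidiagonal_swap,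
    Finset.Nat.sum_antidiagonal_eq_sum_range_succ_mk]
  obtain ⟨n, rfl⟩ : ∃ n, N = n + 4 := ⟨N - 4, by omega⟩
  simp only [Prod.swap_prod_mk]
  rw [show (n + 4).succ = n + 1 + 4 from rfl, Finset.sum_range_succ', Finset.sum_range_succ',
    Finset.sum_range_succ', Finset.sum_range_succ']
  have h0 : 0 ≤ ∑ k ∈ Finset.range (n + 1),
      excess₃ (n + 4 - (k + 1 + 1 + 1 + 1)) * expCoeffDiff (k + 1 + 1 + 1 + 1) :=
    Finset.sum_nonneg fun k _ =>
      mul_nonneg (excess₃_nonneg _) (expCoeffDiff_nonneg_and_monotone k).1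
  have h1 := low_order_nonneg (n := n) (by omega)
  have d1 := congrFun backwardDiff_excess (n + 4)
  have d2 := congrFun backwardDiff_excess₂ (n + 4)
  have d2' := congrFun backwardDiff_excess₂ (n + 3)
  have d3 := congrFun backwardDiff_excess₃ (n + 4)
  have d3' := congrFun backwardDiff_excess₃ (n + 3)
  have d3'' := congrFun backwardDiff_excess₃ (n + 2)
  have g0 : expCoeffDiff 0 = 1 := by norm_num [expCoeffDiff, backwardDiff, expCoeff]
  have g1 : expCoeffDiff 1 = 79 / 100 - 3 := by
    norm_num [expCoeffDiff, backwardDiff, expCoeff]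
  have g2 : expCoeffDiff 2 = 3 - 2 * (79 / 100) + (79 / 100) ^ 2 / 2 := by
    norm_num [expCoeffDiff, backwardDiff, expCoeff]
  have g3 : expCoeffDiff 3 = -1 + 79 / 100 - (79 / 100) ^ 2 / 2 + (79 / 100) ^ 3 / 6 := by
    norm_num [expCoeffDiff, backwardDiff, expCoeff]
  simp only [backwardDiff] at d1 d2 d2' d3 d3' d3''
  push_cast at d1
  simp only [zero_add, Nat.reduceAdd, g0, g1, g2, g3, Nat.sub_zero,
    show n + 4 - 1 = n + 3 by omega, show n + 4 - 2 = n + 2 by omega,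
    show n + 4 - 3 = n + 1 by omega]
  linarith

section Recursion

variable {L : ℕ} {q : ℕ → ℕ}

theorem le_of_sum_oddSigma_mul_le (h0 : 0 < q 0)
    (hrec : ∀ N ≤ L, ∑ s ∈ Finset.Icc 1 N, oddSigma s * q (N - s) ≤ N * q N) :
    (1 ≤ L → 1 ≤ q 1) ∧ (2 ≤ L → 1 ≤ q 2) ∧ (3 ≤ L → 2 ≤ q 3) ∧ (4 ≤ L → 2 ≤ q 4) ∧
      (5 ≤ L → 3 ≤ q 5) ∧ (6 ≤ L → 4 ≤ q 6) ∧ (7 ≤ L → 5 ≤ q 7) ∧ (8 ≤ L → 6 ≤ q 8) := by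
  have s1 : oddSigma 1 = 1 := by decide +kernel
  have s2 : oddSigma 2 = 1 := by decide +kernel
  have s3 : oddSigma 3 = 4 := by decide +kernel
  have s4 : oddSigma 4 = 1 := by decide +kernel
  have s5 : oddSigma 5 = 6 := by decide +kernel
  have s6 : oddSigma 6 = 4 := by decide +kernel
  have s7 : oddSigma 7 = 8 := by decide +kernel
  have s8 : oddSigma 8 = 1 := by decide +kernel
  have r1 := hrec 1
  have r2 := hrec 2
  have r3 := hrec 3
  have r4 := hrec 4
  have r5 := hrec 5
  have r6 := hrec 6
  have r7 := hrec 7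
  have r8 := hrec 8
  norm_num [Finset.sum_Icc_succ_top, s1, s2, s3, s4, s5, s6, s7, s8]
    at r1 r2 r3 r4 r5 r6 r7 r8
  omega

theorem expCoeff_le_of_sum_oddSigma_mul_le (h0 : 0 < q 0)
    (hrec : ∀ N ≤ L, ∑ s ∈ Finset.Icc 1 N, oddSigma s * q (N - s) ≤ N * q N) :
    ∀ N ≤ L, 9 / 10 * expCoeff N ≤ q N := by
  intro N
  induction N using Nat.strong_induction_on with
  | _ N ih =>
    intro hN
    obtain h | h := lt_or_ge N 9
    · obtain ⟨h1, h2, h3, h4, h5, h6, h7, h8⟩ := le_of_sum_oddSigma_mul_le h0 hrec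
      interval_cases N
      · refine le_trans ?_ (Nat.cast_le.mpr h0); norm_num [expCoeff]
      · refine le_trans ?_ (Nat.cast_le.mpr (h1 hN)); norm_num [expCoeff]
      · refine le_trans ?_ (Nat.cast_le.mpr (h2 hN)); norm_num [expCoeff]
      · refine le_trans ?_ (Nat.cast_le.mpr (h3 hN)); norm_num [expCoeff]
      · refine le_trans ?_ (Nat.cast_le.mpr (h4 hN)); norm_num [expCoeff]
      · refine le_trans ?_ (Nat.cast_le.mpr (h5 hN)); norm_num [expCoeff]
      · refine le_trans ?_ (Nat.cast_le.mpr (h6 hN)); norm_num [expCoeff]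
      · refine le_trans ?_ (Nat.cast_le.mpr (h7 hN)); norm_num [expCoeff]
      · refine le_trans ?_ (Nat.cast_le.mpr (h8 hN)); norm_num [expCoeff]
    · have hNpos : (0 : ℝ) < N := by exact_mod_cast (by omega : 0 < N)
      refine le_of_mul_le_mul_left ?_ hNpos
      calc (N : ℝ) * (9 / 10 * expCoeff N) = 9 / 10 * (N * expCoeff N) := by ring
        _ ≤ 9 / 10 * ∑ ij ∈ Finset.HasAntidiagonal.antidiagonal N,
              (oddSigma ij.1 : ℝ) * expCoeff ij.2 := by
            linarith [mul_expCoeff_le_sum h]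
        _ = ∑ s ∈ Finset.Icc 1 N, (oddSigma s : ℝ) * (9 / 10 * expCoeff (N - s)) := by
            rw [Finset.Nat.sum_antidiagonal_eq_sum_range_succ_mk, Finset.range_eq_Ico,
              Finset.sum_eq_sum_Ico_succ_bot (Nat.succ_pos N)]
            have hσ : oddSigma 0 = 0 := by decide +kernel
            have hI : Finset.Ico (0 + 1) N.succ = Finset.Icc 1 N := by
              ext s; simp only [Finset.mem_Ico, Finset.mem_Icc]; omega
            simp only [hσ, Nat.cast_zero, zero_mul, zero_add] at hI ⊢
            rw [hI, Finset.mul_sum]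
            exact Finset.sum_congr rfl fun _ _ => by ring
        _ ≤ ∑ s ∈ Finset.Icc 1 N, (oddSigma s : ℝ) * q (N - s) := by
            refine Finset.sum_le_sum fun s hs => mul_le_mul_of_nonneg_left ?_ (Nat.cast_nonneg _)
            obtain ⟨hs1, hs2⟩ := Finset.mem_Icc.mp hs
            exact ih (N - s) (by omega) (by omega)
        _ ≤ N * q N := by exact_mod_cast hrec N hN

end Recursion

theorem exp_add_exp_neg_le {t : ℝ} (h0 : 0 ≤ t) (h1 : t ≤ 1) :
    Real.exp t + Real.exp (-t) ≤ 2 + t ^ 2 + t ^ 4 / 8 := by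
  have hp := (abs_le.mp (Real.exp_bound (x := t) (by rwa [abs_of_nonneg h0])
    (n := 5) (by norm_num))).2
  have hm := (abs_le.mp (Real.exp_bound (x := -t) (by rwa [abs_neg, abs_of_nonneg h0])
    (n := 5) (by norm_num))).2
  rw [abs_neg] at hm
  rw [abs_of_nonneg h0] at hp hm
  norm_num [Finset.sum_range_succ, Nat.factorial] at hp hm
  have : t ^ 5 ≤ t ^ 4 := pow_le_pow_of_le_one h0 h1 (by norm_num)
  have : 0 ≤ t ^ 4 := by positivity
  nlinarith

/-- `exp ((5/2) √(x/2))` satisfies, for `x ≥ 9`, the reverse of the three-term recursion of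
`n * expCoeff n` as an inequality. -/
theorem exp_sqrt_add_le {x : ℝ} (hx : 9 ≤ x) :
    Real.exp (5 / 2 * √((x + 1) / 2)) + Real.exp (5 / 2 * √((x - 1) / 2)) ≤
      (2 + 79 / 100 / x) * Real.exp (5 / 2 * √(x / 2)) := by
  set s := √(x / 2)
  have hs2 : s ^ 2 = x / 2 := Real.sq_sqrt (by linarith)
  have hs : 2 ≤ s := Real.le_sqrt_of_sq_le (by linarith)
  have hs0 : 0 < s := by linarith
  have hxs : x = 2 * s ^ 2 := by linarith
  have hq : s * (1 / (4 * s)) = 1 / 4 := by field_simp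
  have hq0 : 0 < 1 / (4 * s) := by positivity
  have hq1 : 1 / (4 * s) ≤ 1 := by
    rw [div_le_one (by positivity)]; linarith
  have hup : √((x + 1) / 2) ≤ s + 1 / (4 * s) :=
    Real.sqrt_le_iff.mpr ⟨by positivity, by nlinarith [sq_nonneg (1 / (4 * s))]⟩
  have hdown : √((x - 1) / 2) ≤ s - 1 / (4 * s) :=
    Real.sqrt_le_iff.mpr ⟨by linarith, by nlinarith [sq_nonneg (1 / (4 * s))]⟩
  have ht := exp_add_exp_neg_le (t := 5 / (8 * s)) (by positivity)
    (by rw [div_le_one (by positivity)]; linarith)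
  have hpoly : 2 + (5 / (8 * s)) ^ 2 + (5 / (8 * s)) ^ 4 / 8 ≤ 2 + 79 / 100 / x := by
    have e1 : (5 / (8 * s)) ^ 2 = 25 / 32 / x := by
      rw [hxs]; field_simp; norm_num
    have e2 : (5 / (8 * s)) ^ 4 = (25 / 32 / x) ^ 2 := by rw [← e1]; ring
    rw [e2, e1]
    have hy : 1 / x ≤ 1 / 9 := one_div_le_one_div_of_le (by norm_num) hx
    have hy0 : 0 < 1 / x := by positivity
    have e3 : 25 / 32 / x = 25 / 32 * (1 / x) := by ring
    have e4 : 79 / 100 / x = 79 / 100 * (1 / x) := by ring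
    rw [e3, e4]
    nlinarith
  calc _ ≤ Real.exp (5 / 2 * (s + 1 / (4 * s))) + Real.exp (5 / 2 * (s - 1 / (4 * s))) := by
        gcongr
    _ = (Real.exp (5 / (8 * s)) + Real.exp (-(5 / (8 * s)))) * Real.exp (5 / 2 * s) := by
        rw [add_mul, ← Real.exp_add, ← Real.exp_add]
        congr 2 <;> (field_simp; ring)
    _ ≤ _ := mul_le_mul_of_nonneg_right (ht.trans hpoly) (Real.exp_pos _).le

theorem exp_five_lt : Real.exp 5 < 148.42 := by
  have h := Real.exp_one_lt_d9
  calc Real.exp 5 = Real.exp 1 ^ 5 := by rw [← Real.exp_nat_mul]; norm_num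
    _ < 2.7182818286 ^ 5 := by gcongr
    _ < 148.42 := by norm_num

theorem exp_sqrt_nine_half_le : Real.exp (5 / 2 * √(9 / 2)) ≤ 100 / 69 * Real.exp 5 := by
  have h : √(9 / 2 : ℝ) ≤ 2.124 := Real.sqrt_le_iff.mpr ⟨by norm_num, by norm_num⟩
  have h1 : Real.exp (31 / 100) ≤ 100 / 69 := by
    have := Real.add_one_le_exp (-(31 / 100 : ℝ))
    rw [Real.exp_neg] at this
    have hpos := Real.exp_pos (31 / 100 : ℝ)
    have h2 := mul_le_mul_of_nonneg_left this hpos.le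
    rw [mul_inv_cancel₀ hpos.ne'] at h2
    linarith
  calc Real.exp (5 / 2 * √(9 / 2)) ≤ Real.exp (31 / 100 + 5) := by
        gcongr; linarith
    _ = Real.exp (31 / 100) * Real.exp 5 := Real.exp_add _ _
    _ ≤ _ := by gcongr

theorem exp_sqrt_le_mul_expCoeff {N : ℕ} (hN : 9 ≤ N) :
    2 / 13 * Real.exp (5 / 2 * √(N / 2)) ≤ 9 / 10 * (N * expCoeff N) := by
  set Z : ℕ → ℝ := fun n =>
    9 / 10 * (n * expCoeff n) - 2 / 13 * Real.exp (5 / 2 * √((n : ℝ) / 2)) with hZ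
  have hstep : ∀ n : ℕ, 8 ≤ n → 0 ≤ Z (n + 1) → Z n ≤ Z (n + 1) →
      Z (n + 1) ≤ Z (n + 2) := fun n hn h0 h1 => by
    have hx : (9 : ℝ) ≤ n + 1 := by exact_mod_cast (by omega : 9 ≤ n + 1)
    have h2 := exp_sqrt_add_le hx
    have h3 := expCoeff_rec n
    rw [show (n : ℝ) + 1 + 1 = n + 2 by ring, add_sub_cancel_right, add_mul] at h2
    have h4 : 0 ≤ 79 / 100 / ((n : ℝ) + 1) * Z (n + 1) := by positivity
    have h5 : 79 / 100 / ((n : ℝ) + 1) * (((n : ℝ) + 1) * expCoeff (n + 1))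
        = 79 / 100 * expCoeff (n + 1) := by field_simp
    simp only [hZ] at h1 h4 ⊢
    push_cast at h1 h4 ⊢
    linarith
  have hmain : ∀ n : ℕ, 8 ≤ n → 0 ≤ Z (n + 1) ∧ Z n ≤ Z (n + 1) := fun n hn => by
    induction n, hn using Nat.le_induction with
    | base =>
      have h8 : √((8 : ℝ) / 2) = 2 := by
        rw [show (8 : ℝ) / 2 = 2 ^ 2 by norm_num]; exact Real.sqrt_sq (by norm_num)
      have h5 := exp_five_lt
      have h9 := exp_sqrt_nine_half_le
      have e1 : 2 / 13 * (100 / 69) * 148.42 ≤ 9 / 10 * (9 * expCoeff 9) := by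
        norm_num [expCoeff]
      have e2 : 2 / 13 * (31 / 69) * 148.42 ≤
          9 / 10 * (9 * expCoeff 9) - 9 / 10 * (8 * expCoeff 8) := by
        norm_num [expCoeff]
      simp only [hZ, Nat.reduceAdd]
      push_cast
      rw [h8, show (5 / 2 * 2 : ℝ) = 5 by norm_num]
      constructor <;> linarith
    | succ n hn ih =>
      have := hstep n hn ih.1 ih.2
      exact ⟨ih.1.trans this, this⟩
  obtain ⟨n, rfl⟩ : ∃ n, N = n + 1 := ⟨N - 1, by omega⟩
  have := (hmain n (by omega)).1
  simp only [hZ] at this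
  linarith

theorem exp_sqrt_div_le {x : ℝ} (hx : 1 ≤ x) :
    Real.exp (5 / 2 * √x) / x ≤ 2 * Real.exp (5 / 2 * √((2 * x + 1) / 2)) / (2 * x + 1) := by
  have hx0 : 0 < x := by linarith
  have hs1 : 1 ≤ √x := Real.one_le_sqrt.mpr hx
  have hs2 : √x ^ 2 = x := Real.sq_sqrt hx0.le
  have hy : 1 / (5 * x) * x = 1 / 5 := by field_simp
  have hy0 : 0 < 1 / (5 * x) := by positivity
  have hy1 : 1 / (5 * x) ≤ 1 / 5 := by
    rw [div_le_div_iff₀ (by positivity) (by norm_num)]; linarith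
  have h1 : √x + 1 / (5 * x) ≤ √((2 * x + 1) / 2) := by
    refine Real.le_sqrt_of_sq_le ?_
    have : 1 / (5 * x) * √x ≤ 1 / 5 := by
      rw [← hy]
      gcongr
      nlinarith
    nlinarith
  have h2 : 1 + 1 / (2 * x) ≤ Real.exp (1 / (2 * x)) := by
    linarith [Real.add_one_le_exp (1 / (2 * x))]
  have h3 : Real.exp (5 / 2 * √x) * (1 + 1 / (2 * x)) ≤
      Real.exp (5 / 2 * √((2 * x + 1) / 2)) := by
    calc _ ≤ Real.exp (5 / 2 * √x) * Real.exp (1 / (2 * x)) := by gcongr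
      _ = Real.exp (5 / 2 * (√x + 1 / (5 * x))) := by
        rw [← Real.exp_add]; congr 1; field_simp
      _ ≤ _ := by gcongr
  rw [div_le_div_iff₀ hx0 (by positivity)]
  have h4 := mul_le_mul_of_nonneg_left h3 (by positivity : (0 : ℝ) ≤ 2 * x)
  have h5 : 2 * x * (Real.exp (5 / 2 * √x) * (1 + 1 / (2 * x)))
      = Real.exp (5 / 2 * √x) * (2 * x + 1) := by field_simp
  linarith

theorem exp_sqrt_le_of_sqrt_le {x b : ℝ} {k : ℕ} (hb : 0 ≤ b) (hx : x ≤ b ^ 2)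
    (hk : 5 / 2 * b ≤ k) : Real.exp (5 / 2 * √x) ≤ 2.719 ^ k := by
  have h : √x ≤ b := Real.sqrt_le_iff.mpr ⟨hb, hx⟩
  calc Real.exp (5 / 2 * √x) ≤ Real.exp (k * 1) :=
        Real.exp_le_exp.mpr (by linarith)
    _ = Real.exp 1 ^ k := Real.exp_nat_mul _ _
    _ ≤ 2.719 ^ k := by
      have := Real.exp_one_lt_d9
      gcongr
      linarith

theorem exp_sqrt_div_le_card_oddPartitions {n : ℕ} (hn : 1 ≤ n) :
    Real.exp (5 / 2 * √n) / (13 * n) ≤ (oddPartitions (n + 1) (2 * n + 1)).card := by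
  have h0 := card_oddPartitions_zero_pos (n + 1)
  have hrec : ∀ N ≤ 2 * n + 1, ∑ s ∈ Finset.Icc 1 N,
      oddSigma s * (oddPartitions (n + 1) (N - s)).card ≤
        N * (oddPartitions (n + 1) N).card :=
    fun N hN => sum_oddSigma_mul_card_le (by omega)
  obtain h | h := lt_or_ge n 4
  · obtain ⟨-, -, h3, -, h5, -, h7, -⟩ :=
      le_of_sum_oddSigma_mul_le (q := fun N => (oddPartitions (n + 1) N).card) h0 hrec
    interval_cases n
    · refine le_trans ?_ (Nat.cast_le.mpr (h3 (by norm_num)))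
      have := exp_sqrt_le_of_sqrt_le (x := 1) (b := 1) (k := 3) (by norm_num) (by norm_num)
        (by norm_num)
      push_cast
      linarith
    · refine le_trans ?_ (Nat.cast_le.mpr (h5 (by norm_num)))
      have := exp_sqrt_le_of_sqrt_le (x := 2) (b := 1.6) (k := 4) (by norm_num) (by norm_num)
        (by norm_num)
      push_cast
      linarith
    · refine le_trans ?_ (Nat.cast_le.mpr (h7 (by norm_num)))
      have := exp_sqrt_le_of_sqrt_le (x := 3) (b := 2) (k := 5) (by norm_num) (by norm_num)
        (by norm_num)
      push_cast
      linarith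
  · have h1 := expCoeff_le_of_sum_oddSigma_mul_le
      (q := fun N => (oddPartitions (n + 1) N).card) h0 hrec (2 * n + 1) le_rfl
    have h2 := exp_sqrt_le_mul_expCoeff (N := 2 * n + 1) (by omega)
    have h3 := exp_sqrt_div_le (x := n) (by exact_mod_cast hn)
    push_cast at h2
    have hpos : (0 : ℝ) < 2 * n + 1 := by positivity
    refine le_trans ?_ h1
    calc Real.exp (5 / 2 * √n) / (13 * n) = 1 / 13 * (Real.exp (5 / 2 * √n) / n) := by
          rw [mul_comm, ← div_div]; ring
      _ ≤ 1 / 13 * (2 * Real.exp (5 / 2 * √((2 * n + 1) / 2)) / (2 * n + 1)) := by gcongr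
      _ = (2 / 13 * Real.exp (5 / 2 * √((2 * n + 1) / 2))) / (2 * n + 1) := by ring
      _ ≤ (9 / 10 * ((2 * n + 1) * expCoeff (2 * n + 1))) / (2 * n + 1) := by gcongr
      _ = 9 / 10 * expCoeff (2 * n + 1) := by field_simp

/-- Item (ii) of Theorem 2: if `2 ≤ l < p + 1`, then the set
`T = {(u_0,…,u_{l−1}) ∈ ℤ^l : Σ (i·k+1)·u_i < m, 0 ≤ u_i ≤ p−1}` (with `m = k·l`)
has cardinality at least `exp(2.5·√(l−1)) / (13(l−1))`. -/
theorem card_T_ge_of_l_small (p k l : ℕ) (hp : p.Prime) (hp5 : 5 ≤ p)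
    (hk : 1 < k) (hl2 : 2 ≤ l) (hlp : l < p + 1) :
    Real.exp (2.5 * Real.sqrt ((l : ℝ) - 1)) / (13 * ((l : ℝ) - 1)) ≤
      ({u : Fin l → ℕ | (∀ i, u i ≤ p - 1) ∧
        ∑ i : Fin l, ((i : ℕ) * k + 1) * u i < k * l}.ncard : ℝ) := by
  obtain ⟨n, rfl⟩ : ∃ n, l = n + 1 := ⟨l - 1, by omega⟩
  refine le_trans ?_
    (Nat.cast_le.mpr (card_oddPartitions_le_ncard (Nat.succ_pos n) hk hlp))
  rw [Nat.cast_add_one, add_sub_cancel_right, show 2 * (n + 1) - 1 = 2 * n + 1 by omega,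
    show (2.5 : ℝ) = 5 / 2 by norm_num]
  exact exp_sqrt_div_le_card_oddPartitions (by omega)
end

section
/- Let F_q be a finite field with q elements, m ≥ 2 an integer, and a ∈ F_q* such that x^m − a is irreducible in F_q[x]. Suppose m = k·l where k divides q − 1 and l is the multiplicative order of q modulo m. Then the cyclic subgroup of (Z/mZ)* generated by the class of q equals the set { (i·k + 1) mod m : i = 0, 1, …, l − 1 }. -/
open Polynomial

/-- Lemma 2 of the paper: if `x^m − a` is irreducible over `F_q`, `m = k·l`,
`k ∣ q − 1` and `l` is the multiplicative order of `q` modulo `m`, then the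
cyclic subgroup of `(ℤ/mℤ)*` generated by the class of `q` is exactly
`{(i·k + 1) mod m : 0 ≤ i < l}`. -/
theorem powers_q_eq_arithmetic_classes
    (q m k l : ℕ) (F : Type*) [Field F] [Fintype F] (hcard : Fintype.card F = q)
    (hm : 2 ≤ m) (a : F) (ha : a ≠ 0) (hirr : Irreducible (X ^ m - C a))
    (hkl : m = k * l) (hk : k ∣ q - 1) (hl : orderOf (q : ZMod m) = l) :
    (Submonoid.powers (q : ZMod m) : Set (ZMod m)) =
      {x : ZMod m | ∃ i < l, x = ((i * k + 1 : ℕ) : ZMod m)} := by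
  have hl0 : 0 < l := by
    rcases Nat.eq_zero_or_pos l with rfl | h
    · omega
    · exact h
  have hq : 1 ≤ q := hcard ▸ Fintype.card_pos
  have hset : {x : ZMod m | ∃ i < l, x = ((i * k + 1 : ℕ) : ZMod m)} =
      ((Finset.range l).image fun i : ℕ ↦ ((i * k + 1 : ℕ) : ZMod m) : Finset (ZMod m)) := by
    ext x
    simp [eq_comm]
  have hsub : (Submonoid.powers (q : ZMod m) : Set (ZMod m)) ⊆
      {x : ZMod m | ∃ i < l, x = ((i * k + 1 : ℕ) : ZMod m)} := by
    rintro x ⟨n, rfl⟩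
    obtain ⟨j, hj⟩ : k ∣ q ^ n - 1 := hk.trans (by simpa using Nat.sub_dvd_pow_sub_pow q 1 n)
    have hqn : q ^ n = j * k + 1 := by
      have := Nat.one_le_pow n q hq
      rw [mul_comm j k]
      omega
    refine ⟨j % l, Nat.mod_lt _ hl0, ?_⟩
    change (q : ZMod m) ^ n = _
    rw [← Nat.cast_pow, hqn, ZMod.natCast_eq_natCast_iff, hkl, mul_comm k l]
    exact (((Nat.mod_modEq j l).mul_right' k).add_right 1).symm
  rw [hset] at hsub ⊢
  refine Set.eq_of_subset_of_ncard_le hsub ?_ (Finset.finite_toSet _)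
  rw [Set.ncard_coe_finset]
  calc
    _ ≤ l := Finset.card_image_le.trans_eq (Finset.card_range l)
    _ = (((q : ZMod m) ^ ·) '' Set.Iio l).ncard := by
      rw [Set.InjOn.ncard_image (hl ▸ pow_injOn_Iio_orderOf), Set.ncard_eq_toFinset_card']
      simp
    _ ≤ _ := by
      refine Set.ncard_le_ncard ?_ ((Finset.finite_toSet _).subset hsub)
      rintro _ ⟨n, -, rfl⟩
      exact ⟨n, rfl⟩
end

section
/- Let n₀ and d₀ be positive integers with d₀ ≥ 2. The number of partitions of n₀ in which every part appears at most d₀ − 1 times equals the number of partitions of n₀ in which no part is divisible by d₀. -/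
/-- Glaisher's theorem: the number of partitions of `n₀` in which every part
appears at most `d₀ − 1` times equals the number of partitions of `n₀` in which
no part is divisible by `d₀`. -/
theorem glaisher (n₀ d₀ : ℕ) (hn : 0 < n₀) (hd : 2 ≤ d₀) :
    {P : Nat.Partition n₀ | ∀ j : ℕ, P.parts.count j ≤ d₀ - 1}.ncard =
      {P : Nat.Partition n₀ | ∀ j ∈ P.parts, ¬ d₀ ∣ j}.ncard := by
  have hcount : {P : Nat.Partition n₀ | ∀ j : ℕ, P.parts.count j ≤ d₀ - 1} =
      (Nat.Partition.countRestricted n₀ d₀ : Set (Nat.Partition n₀)) := by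
    ext P
    simp only [Nat.Partition.countRestricted, Finset.coe_filter, Finset.mem_univ, true_and,
      Set.mem_ofPred_eq]
    refine ⟨fun h j _ => by have := h j; omega, fun h j => ?_⟩
    by_cases hj : j ∈ P.parts
    · have := h j hj
      omega
    · simp [Multiset.count_eq_zero_of_notMem hj]
  have hdvd : {P : Nat.Partition n₀ | ∀ j ∈ P.parts, ¬ d₀ ∣ j} =
      (Nat.Partition.restricted n₀ (¬ d₀ ∣ ·) : Set (Nat.Partition n₀)) := by
    ext P
    simp [Nat.Partition.restricted]
  rw [hcount, hdvd, Set.ncard_coe_finset, Set.ncard_coe_finset]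
  exact (Nat.Partition.card_restricted_eq_card_countRestricted n₀ (by omega)).symm
end
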